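/- arXiv:2401.11930 — 2 statements merged into one kernel-verified Lean document; each statement's English description precedes it below -/
import Mathlib

section
/- Let C be a field, let T ⊇ T₀ be an 𝔏_val(C)-theory of valued fields extending the trivially valued field C, and suppose T satisfies condition (*): any two models (F,v), (F′,v′) of T whose residue fields Fv and F′v′ have the same universal/existential 𝔏_ring(C)-theory have the same universal/existential 𝔏_val(C)-theory. Then for every model (F,v) of T, the universal/existential 𝔏_val(C)-theory of (F,v) equals the set of universal/existential consequences of the theory T(Th_{∀/∃}(Fv)), i.e. Th_{∀/∃}(F,v) = T(Th_{∀/∃}(Fv))_{∀/∃}. -/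
open FirstOrder Language

/-- The language with a single unary relation symbol `𝒪`. -/
def LO : Language :=
  ⟨fun _ => Empty, fun n => match n with | 1 => PUnit | _ => Empty⟩

/-- The one-sorted language of valued fields `𝔏_val = 𝔏_ring ∪ {𝒪}`. -/
def Lval : Language := Language.ring.sum LO

/-- The `LO`-structure on a type given by a subset interpreting `𝒪`. -/
def LOStructure {F : Type*} (O : Set F) : LO.Structure F where
  funMap := fun f _ => f.elim
  RelMap := fun {n} r x =>
    match n, r, x with
    | 1, _, x => x 0 ∈ O

/-- The canonical `ring`-structure on a field. -/
noncomputable def ringStructure (F : Type*) [Field F] : Language.ring.Structure F :=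
  (Ring.compatibleRingOfRing F).toStructure

/-- The `Lval`-structure of a valued field, `𝒪` interpreted as the valuation ring. -/
noncomputable def valStructure (F : Type*) [Field F] (O : ValuationSubring F) :
    Lval.Structure F :=
  letI := ringStructure F
  letI := LOStructure (O : Set F)
  Language.sumStructure _ _ F

/-- The `Lval[[C]]`-structure of a valued field with constants interpreted via `ι`. -/
noncomputable def valCStructure (C : Type*) (F : Type*) [Field F] (ι : C → F)
    (O : ValuationSubring F) : (Lval[[C]]).Structure F :=
  letI := valStructure F O
  letI := constantsOn.structure ι
  Language.sumStructure _ _ F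

/-- The `ring[[C]]`-structure on a field with constants interpreted via `ι`. -/
noncomputable def ringCStructure (C : Type*) (F : Type*) [Field F] (ι : C → F) :
    (Language.ring[[C]]).Structure F :=
  letI := ringStructure F
  letI := constantsOn.structure ι
  Language.sumStructure _ _ F

/-- Satisfaction of an `𝔏_val`-sentence in a valued field. -/
def SatV {F : Type*} [Field F] (O : ValuationSubring F) (φ : Lval.Sentence) : Prop :=
  letI := valStructure F O
  F ⊨ φ

/-- Satisfaction of an `𝔏_val(C)`-sentence in a valued field with constants `ι`. -/
def SatVC (C : Type*) {F : Type*} [Field F] (ι : C → F) (O : ValuationSubring F)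
    (φ : (Lval[[C]]).Sentence) : Prop :=
  letI := valCStructure C F ι O
  F ⊨ φ

/-- Satisfaction of an `𝔏_ring`-sentence in a field. -/
def SatR (F : Type*) [Field F] (φ : Language.ring.Sentence) : Prop :=
  letI := ringStructure F
  F ⊨ φ

/-- Satisfaction of an `𝔏_ring(C)`-sentence in a field with constants `ι`. -/
def SatRC (C : Type*) (F : Type*) [Field F] (ι : C → F)
    (φ : (Language.ring[[C]]).Sentence) : Prop :=
  letI := ringCStructure C F ι
  F ⊨ φ

/-- An existential sentence: a quantifier-free formula with all variables
existentially quantified. -/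
def IsExistentialSen {L : Language} (φ : L.Sentence) : Prop :=
  ∃ (n : ℕ) (ψ : L.BoundedFormula Empty n), ψ.IsQF ∧ φ = ψ.exs

/-- A universal sentence. -/
def IsUniversalSen {L : Language} (φ : L.Sentence) : Prop :=
  ∃ (n : ℕ) (ψ : L.BoundedFormula Empty n), ψ.IsQF ∧ φ = ψ.alls

/-- A universal/existential sentence: a finite conjunction/disjunction combination of
existential and universal sentences. -/
inductive IsUE {L : Language} : L.Sentence → Prop
  | ex {φ} : IsExistentialSen φ → IsUE φ
  | all {φ} : IsUniversalSen φ → IsUE φ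
  | inf {φ ψ} : IsUE φ → IsUE ψ → IsUE (φ ⊓ ψ)
  | sup {φ ψ} : IsUE φ → IsUE ψ → IsUE (φ ⊔ ψ)
/-- A place of a function field `K` over `k` (given by `ι : k →+* K`): a nontrivial
valuation subring of `K` containing (the image of) `k`. -/
def IsPlace {k K : Type*} [Field k] [Field K] (ι : k →+* K) (O : ValuationSubring K) : Prop :=
  O ≠ ⊤ ∧ ∀ c, ι c ∈ O

/-- `K/k` is a function field of one variable: finitely generated of transcendence
degree 1 (equivalently, finite over `k(t)` for some transcendental `t`), with `k`
relatively algebraically closed in `K`. -/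
structure IsFunctionField (k K : Type*) [Field k] [Field K] [Algebra k K] : Prop where
  exists_primitive : ∃ t : K, Transcendental k t ∧
    FiniteDimensional ↥(IntermediateField.adjoin k {t}) K
  constants_closed : ∀ x : K, IsAlgebraic k x → ∃ c : k, algebraMap k K c = x

section Completion

variable (K : Type*) [Field K] (v : ValuationSubring K)

/-- The completion `K̂_v` of the valued field `(K, v)`. -/
noncomputable def Cmpl : Type _ :=
  letI := Valued.mk' v.valuation
  UniformSpace.Completion K

noncomputable instance : Field (Cmpl K v) :=
  letI := Valued.mk' v.valuation
  UniformSpace.Completion.instField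

/-- The valuation ring of the canonical extension of `v` to the completion `K̂_v`. -/
noncomputable def cmplO : ValuationSubring (Cmpl K v) := by
  letI := Valued.mk' v.valuation
  letI : Field (UniformSpace.Completion K) := UniformSpace.Completion.instField
  letI : Valued (UniformSpace.Completion K) v.ValueGroup := Valued.valuedCompletion
  exact (Valued.v : Valuation (UniformSpace.Completion K) v.ValueGroup).valuationSubring

/-- The canonical embedding of `K` into its completion `K̂_v`. -/
noncomputable def cmplEmb : K →+* Cmpl K v := by
  letI := Valued.mk' v.valuation
  letI : Field (UniformSpace.Completion K) := UniformSpace.Completion.instField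
  exact UniformSpace.Completion.coeRingHom

end Completion

section Residue

variable {F : Type*} [Field F] (O : ValuationSubring F)

/-- The residue field `Fv` of a valued field. -/
noncomputable abbrev ResF := IsLocalRing.ResidueField ↥O

/-- The interpretation of constants from `C` in the residue field, via the residue map. -/
noncomputable def resConst {C : Type*} (ι : C → F) (h : ∀ c, ι c ∈ O) :
    C → ResF O :=
  fun c => IsLocalRing.residue _ ⟨ι c, h c⟩

/-- The interpretation of constants from `C` in the residue field, via the residue map,
extended by `0` outside the valuation ring. -/
noncomputable def resConstExt {C : Type*} (ι : C → F) : C → ResF O :=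
  open scoped Classical in
  fun c => if h : ι c ∈ O then IsLocalRing.residue _ ⟨ι c, h⟩ else 0

end Residue

/-- A field is pseudofinite if it is infinite and models the first-order theory of
the class of all finite fields. -/
def IsPseudofinite (F : Type*) [Field F] : Prop :=
  Infinite F ∧ ∀ φ : Language.ring.Sentence,
    (∀ (E : Type) (_ : Field E) (_ : Finite E), SatR E φ) → SatR F φ
/-- A valued field extending the trivially valued field `C`
(an `𝔏_val(C)`-structure which is a valued field with valuation trivial on `C`). -/
structure VF (C : Type) [Field C] : Type 1 where
  carrier : Type
  [fieldCarrier : Field carrier]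
  O : ValuationSubring carrier
  emb : C →+* carrier
  triv : ∀ c : C, emb c ∈ O

attribute [instance] VF.fieldCarrier

variable {C : Type} [Field C]

/-- Satisfaction of `𝔏_val(C)`-sentences in a valued field extending `C`. -/
def VF.Sat (A : VF C) (φ : (Lval[[C]]).Sentence) : Prop :=
  SatVC C (⇑A.emb) A.O φ

/-- Satisfaction of `𝔏_ring(C)`-sentences in the residue field of a valued field
extending `C`, the constants being interpreted via the residue map. -/
def VF.resSat (A : VF C) (ψ : (Language.ring[[C]]).Sentence) : Prop :=
  SatRC C (ResF A.O) (resConst A.O (⇑A.emb) A.triv) ψ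

/-- `A` is a model of the `𝔏_val(C)`-theory `T`. -/
def VF.ModelsT (T : Set (Lval[[C]]).Sentence) (A : VF C) : Prop :=
  ∀ φ ∈ T, A.Sat φ

/-- The universal/existential `𝔏_val(C)`-theory of a valued field extending `C`. -/
def VF.ThUEv (A : VF C) : Set (Lval[[C]]).Sentence :=
  {φ | IsUE φ ∧ A.Sat φ}

/-- The universal/existential `𝔏_ring(C)`-theory of the residue field. -/
def VF.ThUEr (A : VF C) : Set (Language.ring[[C]]).Sentence :=
  {ψ | IsUE ψ ∧ A.resSat ψ}

/-- `T₀`: the `𝔏_val(C)`-theory of valued fields extending the trivially valued field `C`. -/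
def T0 (C : Type) [Field C] : Set (Lval[[C]]).Sentence :=
  {φ | ∀ A : VF C, A.Sat φ}

/-- `T(R)`: the (complete) theory of the class of models `(F,v)` of `T` whose residue
field is a model of `R`. -/
def TofR (T : Set (Lval[[C]]).Sentence) (R : Set (Language.ring[[C]]).Sentence) :
    Set (Lval[[C]]).Sentence :=
  {φ | ∀ A : VF C, A.ModelsT T → (∀ ψ ∈ R, A.resSat ψ) → A.Sat φ}

/-- Condition `(∗)`: any two models of `T` whose residue fields have the same
universal/existential `𝔏_ring(C)`-theory have the same universal/existential
`𝔏_val(C)`-theory. -/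
def StarCond (T : Set (Lval[[C]]).Sentence) : Prop :=
  ∀ A B : VF C, A.ModelsT T → B.ModelsT T → A.ThUEr = B.ThUEr → A.ThUEv = B.ThUEv

/-- The set of universal/existential consequences `T_{∀/∃}` of a theory. -/
def UECons {L : Language} (T : L.Theory) : Set L.Sentence :=
  {φ | IsUE φ ∧ ∀ M : Theory.ModelType.{0,0,0} T, Sentence.Realize M.Carrier φ}

/-- The set of universal/existential consequences of an `𝔏_ring(C)`-theory. -/
def RDedClosed {L : Language} (R : L.Theory) : Prop :=
  ∀ ψ : L.Sentence, (∀ M : Theory.ModelType.{0,0,0} R, Sentence.Realize M.Carrier ψ) → ψ ∈ R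

/-- `R₀`: the `𝔏_ring(C)`-theory of the class of residue fields of models of `T`. -/
def R0 (T : Set (Lval[[C]]).Sentence) : Set (Language.ring[[C]]).Sentence :=
  {ψ | ∀ A : VF C, A.ModelsT T → A.resSat ψ}
/-- Universal/existential sentences are closed under negation, up to equivalence. -/
theorem IsUE.exists_realize_iff_not {L : Language} {φ : L.Sentence} (h : IsUE φ) :
    ∃ φ' : L.Sentence, IsUE φ' ∧
      ∀ (M : Type) [L.Structure M] [Nonempty M], M ⊨ φ' ↔ ¬ M ⊨ φ := by
  induction h with
  | ex h =>
    obtain ⟨n, ψ, hψ, rfl⟩ := h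
    refine ⟨ψ.not.alls, .all ⟨n, ψ.not, hψ.not, rfl⟩, fun M _ _ => ?_⟩
    simp [Sentence.Realize, BoundedFormula.realize_alls, BoundedFormula.realize_exs]
  | all h =>
    obtain ⟨n, ψ, hψ, rfl⟩ := h
    refine ⟨ψ.not.exs, .ex ⟨n, ψ.not, hψ.not, rfl⟩, fun M _ _ => ?_⟩
    simp [Sentence.Realize, BoundedFormula.realize_alls, BoundedFormula.realize_exs]
  | inf _ _ ih₁ ih₂ =>
    obtain ⟨φ₁, h₁, e₁⟩ := ih₁
    obtain ⟨φ₂, h₂, e₂⟩ := ih₂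
    refine ⟨φ₁ ⊔ φ₂, .sup h₁ h₂, fun M _ _ => ?_⟩
    have e₁ := e₁ M
    have e₂ := e₂ M
    simp only [Sentence.Realize, Formula.realize_sup, Formula.realize_inf] at *
    tauto
  | sup _ _ ih₁ ih₂ =>
    obtain ⟨φ₁, h₁, e₁⟩ := ih₁
    obtain ⟨φ₂, h₂, e₂⟩ := ih₂
    refine ⟨φ₁ ⊓ φ₂, .inf h₁ h₂, fun M _ _ => ?_⟩
    have e₁ := e₁ M
    have e₂ := e₂ M
    simp only [Sentence.Realize, Formula.realize_sup, Formula.realize_inf] at *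
    tauto

/-- An inclusion between universal/existential theories of residue fields is an equality. -/
theorem VF.ThUEr_eq_of_subset {C : Type} [Field C] {A B : VF C} (h : A.ThUEr ⊆ B.ThUEr) :
    A.ThUEr = B.ThUEr := by
  refine h.antisymm fun ψ ⟨hψ, hB⟩ => ⟨hψ, ?_⟩
  obtain ⟨ψ', hψ', e⟩ := hψ.exists_realize_iff_not
  by_contra hA
  have hA' : A.resSat ψ' :=
    letI := ringCStructure C (ResF A.O) (resConst A.O (⇑A.emb) A.triv)
    (e (ResF A.O)).2 hA
  have hB' : ¬ B.resSat ψ :=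
    letI := ringCStructure C (ResF B.O) (resConst B.O (⇑B.emb) B.triv)
    (e (ResF B.O)).1 (h ⟨hψ', hA'⟩).2
  exact hB' hB

/-- Lemma, part (a). -/
theorem UE_theory_eq_UECons_TofR (C : Type) [Field C] (T : Set (Lval[[C]]).Sentence)
    (hT0 : T0 C ⊆ T) (hstar : StarCond T) :
    ∀ A : VF C, A.ModelsT T → A.ThUEv = UECons (TofR T A.ThUEr) := by
  intro A hA
  ext φ
  constructor
  · rintro ⟨hφ, hAφ⟩
    refine ⟨hφ, fun M => Theory.realize_sentence_of_mem (TofR T A.ThUEr) ?_⟩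
    intro B hB hres
    have h := VF.ThUEr_eq_of_subset (A := A) (B := B) fun ψ hψ => ⟨hψ.1, hres ψ hψ⟩
    have hφA : φ ∈ A.ThUEv := ⟨hφ, hAφ⟩
    rw [hstar A B hA hB h] at hφA
    exact hφA.2
  · rintro ⟨hφ, hM⟩
    letI := valCStructure C A.carrier (⇑A.emb) A.O
    haveI : A.carrier ⊨ TofR T A.ThUEr := ⟨fun χ hχ => hχ A hA fun _ hψ => hψ.2⟩
    exact ⟨hφ, hM (Theory.ModelType.of (TofR T A.ThUEr) A.carrier)⟩
end

section
/- Let K be a global function field with field of constants k = 𝔽_q. Then the map ℙ_K → ℕ, v ↦ |Kv|, has finite fibres, and the set R(K) = {|Kv| : v ∈ ℙ_K} is a cofinite subset of {qⁿ : n ∈ ℕ}. More precisely, if K = K_f = Quot(𝔽_q[t,x]/(f)) for an absolutely irreducible polynomial f ∈ 𝔽_q[t,x] of total degree deg(f), then every prime power qⁿ not lying in R(K) satisfies qⁿ ≤ q^{2·deg(f)²}. -/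
open FirstOrder Language

section Places

variable (k K : Type) [Field k] [Field K] [Algebra k K]

/-- The set `ℙ_K` of places of the function field `K/k`. -/
def Places : Type :=
  {O : ValuationSubring K // IsPlace (algebraMap k K) O}

variable {k K}

/-- Satisfaction of an `𝔏_val`-sentence in the completion `K̂_v` at a place `v ∈ ℙ_K`. -/
def SatCmpl (v : Places k K) (φ : Lval.Sentence) : Prop :=
  SatV (cmplO K v.1) φ

/-- Satisfaction of an `𝔏_val(K)`-sentence in the completion `K̂_v` at a place `v ∈ ℙ_K`,
the constants from `K` being interpreted via the canonical embedding `K → K̂_v`. -/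
def SatCmplC (v : Places k K) (φ : (Lval[[K]]).Sentence) : Prop :=
  SatVC K (⇑(cmplEmb K v.1)) (cmplO K v.1) φ

/-- Satisfaction of an `𝔏_ring`-sentence in the residue field `Kv` at a place `v ∈ ℙ_K`. -/
def SatRes (v : Places k K) (ψ : Language.ring.Sentence) : Prop :=
  SatR (ResF v.1) ψ

/-- Satisfaction of an `𝔏_ring(K)`-sentence in the residue field `Kv` at a place `v ∈ ℙ_K`,
the constants from `K` being interpreted via the residue map. -/
def SatResC (v : Places k K) (ψ : (Language.ring[[K]]).Sentence) : Prop :=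
  SatRC K (ResF v.1) (resConstExt v.1 id) ψ

end Places

/-- `(F, O)` is an equicharacteristic henselian nontrivially valued field. -/
def EqHensNontriv (F : Type) [Field F] (O : ValuationSubring F) : Prop :=
  HenselianLocalRing ↥O ∧ O ≠ ⊤ ∧ ringChar F = ringChar (ResF O)

namespace CurvePoints

open Polynomial Module
open scoped Polynomial.Bivariate

section Weights

variable {k 𝒜 : Type*} [Field k] [CommRing 𝒜] [Algebra k 𝒜]

/-- If `z ^ m` is a combination of monomials of smaller degree in `z` and weight at most `e * m`,
where `x` has weight `1` and `y`, `z` have weight `e`, then every monomial can be reduced to degree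
less than `m` in `z` without increasing the weight. -/
theorem monomial_mem_span_of_relation {x y z : 𝒜} {e m : ℕ}
    (hz : z ^ m ∈ Submodule.span k
      {w | ∃ i j l, l < m ∧ i + e * (j + l) ≤ e * m ∧ w = x ^ i * y ^ j * z ^ l})
    (l i j t : ℕ) (h : i + e * (j + l) ≤ t) :
    x ^ i * y ^ j * z ^ l ∈ Submodule.span k
      {w | ∃ i j l, l < m ∧ i + e * (j + l) ≤ t ∧ w = x ^ i * y ^ j * z ^ l} := by
  induction l using Nat.strong_induction_on generalizing i j with
  | _ l ih =>
  rcases lt_or_ge l m with hl | hl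
  · exact Submodule.subset_span ⟨i, j, l, hl, h, rfl⟩
  · obtain ⟨d, rfl⟩ := Nat.exists_eq_add_of_le hl
    rw [pow_add, ← mul_assoc]
    refine Submodule.span_induction (p := fun w _ => x ^ i * y ^ j * w * z ^ d ∈ Submodule.span k
      {w | ∃ i j l, l < m ∧ i + e * (j + l) ≤ t ∧ w = x ^ i * y ^ j * z ^ l}) ?_ ?_ ?_ ?_ hz
    · rintro w ⟨i', j', l', hl', hw, rfl⟩
      have := ih (l' + d) (by omega) (i + i') (j + j') (by ring_nf at *; omega)
      convert! this using 1
      ring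
    · simp
    · intro a b _ _ ha hb
      convert! add_mem ha hb using 1
      ring
    · intro c a _ ha
      convert! Submodule.smul_mem _ c ha using 1
      simp only [Algebra.mul_smul_comm, Algebra.smul_mul_assoc]

/-- Indices `⟨j, i⟩` of the monomials `x ^ i * y ^ j` with `j < m` and `i + e * j ≤ t`. -/
def wtIdx (e m t : ℕ) : Finset (Σ _ : ℕ, ℕ) :=
  (Finset.range m).sigma fun j => Finset.range (t + 1 - e * j)

theorem mem_wtIdx {e m t : ℕ} {p : Σ _ : ℕ, ℕ} :
    p ∈ wtIdx e m t ↔ p.1 < m ∧ p.2 + e * p.1 ≤ t := by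
  simp only [wtIdx, Finset.mem_sigma, Finset.mem_range]
  omega

theorem card_wtIdx (e m t : ℕ) :
    (wtIdx e m t).card = ∑ j ∈ Finset.range m, (t + 1 - e * j) := by
  simp [wtIdx]

theorem le_card_wtIdx (e m t : ℕ) : m * (t + 1 - e * (m - 1)) ≤ (wtIdx e m t).card := by
  rw [card_wtIdx]
  calc m * (t + 1 - e * (m - 1)) = ∑ j ∈ Finset.range m, (t + 1 - e * (m - 1)) := by simp
    _ ≤ _ := Finset.sum_le_sum fun j hj => by
        have : e * j ≤ e * (m - 1) := Nat.mul_le_mul_left _ (by simp at hj; omega)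
        omega

theorem card_wtIdx_add_le (e m t a : ℕ) :
    (wtIdx e m (t + a)).card ≤ (wtIdx e m t).card + m * a := by
  rw [card_wtIdx, card_wtIdx]
  calc _ ≤ ∑ j ∈ Finset.range m, ((t + 1 - e * j) + a) :=
        Finset.sum_le_sum fun j _ => by omega
    _ = _ := by simp [Finset.sum_add_distrib]

variable (k) in
/-- The span of the monomials indexed by `wtIdx e m t`. -/
def wtSpan (x y : 𝒜) (e m t : ℕ) : Submodule k 𝒜 :=
  Submodule.span k (Set.range fun p : wtIdx e m t => x ^ p.1.2 * y ^ p.1.1)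

/-- `F` has weight at most `e * m`, where `X` has weight `1` and `Y` has weight `e`. -/
def WtBound (F : k[X][Y]) (e m : ℕ) : Prop :=
  ∀ j ≤ m, (F.coeff j).natDegree + e * j ≤ e * m

theorem aevalAeval_eq_sum (x y : 𝒜) (F : k[X][Y]) {n : ℕ} (hn : F.natDegree < n) :
    aevalAeval x y F = ∑ j ∈ Finset.range n, aeval x (F.coeff j) * y ^ j := by
  conv_lhs => rw [F.as_sum_range' n hn]
  rw [map_sum]
  refine Finset.sum_congr rfl fun j _ => ?_
  rw [← C_mul_X_pow_eq_monomial, map_mul, map_pow]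
  simp

theorem pow_mem_of_monic {x y : 𝒜} {F : k[X][Y]} {e : ℕ} (hF : F.Monic)
    (hw : WtBound F e F.natDegree) (h0 : aevalAeval x y F = 0) :
    y ^ F.natDegree ∈ Submodule.span k {w | ∃ i j l, l < F.natDegree ∧
      i + e * (j + l) ≤ e * F.natDegree ∧ w = x ^ i * 1 ^ j * y ^ l} := by
  have h1 := aevalAeval_eq_sum x y F (Nat.lt_succ_self _)
  rw [h0, Finset.sum_range_succ, coeff_natDegree, hF.leadingCoeff, map_one, one_mul] at h1
  rw [← neg_eq_of_add_eq_zero_right h1.symm]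
  refine neg_mem (sum_mem fun j hj => ?_)
  rw [aeval_eq_sum_range, Finset.sum_mul]
  refine sum_mem fun i hi => ?_
  rw [Algebra.smul_mul_assoc]
  refine Submodule.smul_mem _ _ (Submodule.subset_span ⟨i, 0, j, by simpa using hj, ?_, by simp⟩)
  have := hw j (by simp at hj; omega)
  simp at hi
  simp
  omega

theorem monomial_mem_wtSpan {x y : 𝒜} {F : k[X][Y]} {e : ℕ} (hF : F.Monic)
    (hw : WtBound F e F.natDegree) (h0 : aevalAeval x y F = 0) {i j t : ℕ} (h : i + e * j ≤ t) :
    x ^ i * y ^ j ∈ wtSpan k x y e F.natDegree t := by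
  have := monomial_mem_span_of_relation (pow_mem_of_monic hF hw h0) j i 0 t (by simpa using h)
  simp only [one_pow, mul_one] at this
  refine Submodule.span_mono ?_ this
  rintro w ⟨i', j', l', hl, h', rfl⟩
  refine ⟨⟨⟨l', i'⟩, mem_wtIdx.2 ⟨hl, ?_⟩⟩, rfl⟩
  ring_nf at *
  omega

theorem mul_mem_wtSpan {x y : 𝒜} {F : k[X][Y]} {e : ℕ} (hF : F.Monic)
    (hw : WtBound F e F.natDegree) (h0 : aevalAeval x y F = 0) {s t : ℕ} {a b : 𝒜}
    (ha : a ∈ wtSpan k x y e F.natDegree s) (hb : b ∈ wtSpan k x y e F.natDegree t) :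
    a * b ∈ wtSpan k x y e F.natDegree (s + t) := by
  have := Submodule.mul_mem_mul ha hb
  rw [wtSpan, wtSpan, Submodule.span_mul_span] at this
  refine Submodule.span_le.2 ?_ this
  rintro _ ⟨_, ⟨p, rfl⟩, _, ⟨q, rfl⟩, rfl⟩
  have hp := mem_wtIdx.1 p.2
  have hq := mem_wtIdx.1 q.2
  have := monomial_mem_wtSpan hF hw h0 (i := p.1.2 + q.1.2) (j := p.1.1 + q.1.1) (t := s + t)
    (by ring_nf at *; omega)
  convert! this using 1
  ring

/-- The polynomial with coefficients `c` on the monomials indexed by `wtIdx e m t`. -/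
noncomputable def wtPoly {e m t : ℕ} (c : wtIdx e m t → k) : k[X][Y] :=
  ∑ p, monomial p.1.1 (monomial p.1.2 (c p))

theorem coeff_wtPoly {e m t : ℕ} (c : wtIdx e m t → k) (p : wtIdx e m t) :
    ((wtPoly c).coeff p.1.1).coeff p.1.2 = c p := by
  classical
  simp only [wtPoly, finsetSum_coeff, coeff_monomial]
  rw [Finset.sum_eq_single p]
  · simp
  · rintro ⟨⟨j, i⟩, hq⟩ _ hne
    obtain ⟨⟨j', i'⟩, hp⟩ := p
    by_cases hj : j = j'
    · subst hj
      have : i ≠ i' := fun h => hne (by subst h; rfl)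
      simp [coeff_monomial, this]
    · simp [hj]
  · simp

theorem wtPoly_coeff_eq_zero_of_le {e m t : ℕ} (c : wtIdx e m t → k) {j : ℕ} (hj : m ≤ j) :
    (wtPoly c).coeff j = 0 := by
  simp only [wtPoly, finsetSum_coeff, coeff_monomial]
  refine Finset.sum_eq_zero fun p _ => if_neg ?_
  have := (mem_wtIdx.1 p.2).1
  omega

theorem degree_wtPoly_lt {e m t : ℕ} (c : wtIdx e m t → k) : (wtPoly c).degree < m :=
  (degree_lt_iff_coeff_zero _ _).2 fun _ hj => wtPoly_coeff_eq_zero_of_le c hj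

theorem natDegree_coeff_wtPoly_le {e m t : ℕ} (c : wtIdx e m t → k) (j : ℕ) :
    ((wtPoly c).coeff j).natDegree ≤ t := by
  simp only [wtPoly, finsetSum_coeff, coeff_monomial]
  refine natDegree_sum_le_of_forall_le _ _ fun p _ => ?_
  split_ifs
  · refine (natDegree_monomial_le _).trans ?_
    have := (mem_wtIdx.1 p.2).2
    omega
  · simp

theorem aevalAeval_wtPoly {e m t : ℕ} (c : wtIdx e m t → k) (x y : 𝒜) :
    aevalAeval x y (wtPoly c) = ∑ p, c p • (x ^ p.1.2 * y ^ p.1.1) := by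
  rw [wtPoly, map_sum]
  refine Finset.sum_congr rfl fun p _ => ?_
  rw [← C_mul_X_pow_eq_monomial, ← C_mul_X_pow_eq_monomial, map_mul, map_pow]
  simp [Algebra.smul_def, mul_assoc]

theorem eq_zero_of_wtPoly_eq_zero {e m t : ℕ} {c : wtIdx e m t → k} (h : wtPoly c = 0) : c = 0 := by
  funext p
  rw [← coeff_wtPoly c p, h]
  simp

theorem exists_wtPoly_of_mem {x y a : 𝒜} {e m t : ℕ} (h : a ∈ wtSpan k x y e m t) :
    ∃ c : wtIdx e m t → k, aevalAeval x y (wtPoly c) = a := by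
  obtain ⟨c, hc⟩ := (Submodule.mem_span_range_iff_exists_fun k).1 h
  exact ⟨c, by rw [aevalAeval_wtPoly]; exact hc⟩

theorem linearIndependent_monomials {x y : 𝒜} {F : k[X][Y]} {e t : ℕ} (hF : F.Monic)
    (hker : ∀ P, aevalAeval x y P = 0 → F ∣ P) :
    LinearIndependent k fun p : wtIdx e F.natDegree t => x ^ p.1.2 * y ^ p.1.1 := by
  rw [Fintype.linearIndependent_iff]
  intro c hc
  rw [← aevalAeval_wtPoly] at hc
  refine fun p => congrFun (eq_zero_of_wtPoly_eq_zero ?_) p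
  refine eq_zero_of_dvd_of_degree_lt (hker _ hc) ?_
  rw [degree_eq_natDegree hF.ne_zero]
  exact degree_wtPoly_lt c

theorem finrank_wtSpan {x y : 𝒜} {F : k[X][Y]} {e t : ℕ} (hF : F.Monic)
    (hker : ∀ P, aevalAeval x y P = 0 → F ∣ P) :
    finrank k (wtSpan k x y e F.natDegree t) = (wtIdx e F.natDegree t).card := by
  rw [wtSpan, finrank_span_eq_card (linearIndependent_monomials hF hker), Fintype.card_coe]

instance {x y : 𝒜} {e m t : ℕ} : FiniteDimensional k (wtSpan k x y e m t) :=
  FiniteDimensional.span_of_finite k (Set.finite_range _)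

/-- A nonzero element of weight at most `A` divides a nonzero polynomial in `x` of degree at
most `m * A`. -/
theorem exists_multiple_eq_aeval [IsDomain 𝒜] {x y : 𝒜} {F : k[X][Y]} {e : ℕ} (hF : F.Monic)
    (hm : 0 < F.natDegree)
    (hw : WtBound F e F.natDegree) (h0 : aevalAeval x y F = 0)
    (hker : ∀ P, aevalAeval x y P = 0 → F ∣ P) {A : ℕ} {g : 𝒜}
    (hg : g ∈ wtSpan k x y e F.natDegree A) (hg0 : g ≠ 0) :
    ∃ (N : k[X]) (V : k[X][Y]), N ≠ 0 ∧ N.natDegree ≤ F.natDegree * A ∧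
      aeval x N = g * aevalAeval x y V := by
  set m := F.natDegree with hmdef
  obtain ⟨s, hs⟩ := Nat.exists_eq_add_of_le (Nat.le_mul_of_pos_left A hm)
  have hs' : m * A = s + A := by omega
  let W := wtSpan k x y e m (s + A)
  let U := (wtSpan k x y e m s).map (LinearMap.mulLeft k g)
  let P := (degreeLT k (s + A + 1)).map (aeval x : k[X] →ₐ[k] 𝒜).toLinearMap
  have hx : Function.Injective (aeval x : k[X] →ₐ[k] 𝒜) := by
    rw [injective_iff_map_eq_zero]
    intro N hN
    have h1 : F ∣ C N := hker _ (by simpa using hN)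
    by_contra hN0
    have := natDegree_le_of_dvd h1 (by simpa using hN0)
    simp at this
    omega
  have hU : finrank k U = (wtIdx e m s).card := by
    rw [← finrank_wtSpan hF hker]
    exact (Submodule.equivMapOfInjective (LinearMap.mulLeft k g)
      (mul_right_injective₀ hg0) _).finrank_eq.symm
  have hP : finrank k P = s + A + 1 := by
    have hd : finrank k (degreeLT k (s + A + 1)) = s + A + 1 := by
      rw [(degreeLTEquiv k (s + A + 1)).finrank_eq, finrank_fin_fun]
    rw [← hd]
    exact (Submodule.equivMapOfInjective (aeval x : k[X] →ₐ[k] 𝒜).toLinearMap hx _).finrank_eq.symm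
  have hUW : U ≤ W := by
    rintro _ ⟨u, hu, rfl⟩
    simpa [W, add_comm, mul_comm] using mul_mem_wtSpan hF hw h0 hg hu
  have hPW : P ≤ W := by
    rintro _ ⟨N, hN, rfl⟩
    have hN := mem_degreeLT.1 hN
    have hN : N.natDegree < s + A + 1 := by
      by_cases h : N = 0
      · simp [h]
      · exact (natDegree_lt_iff_degree_lt h).2 hN
    simp only [AlgHom.toLinearMap_apply, aeval_eq_sum_range]
    refine sum_mem fun i hi => Submodule.smul_mem _ _ ?_
    simp at hi
    simpa using monomial_mem_wtSpan (i := i) (j := 0) hF hw h0 (t := s + A) (by omega)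
  have hW : finrank k W ≤ finrank k U + m * A := by
    rw [hU, finrank_wtSpan hF hker]
    exact card_wtIdx_add_le e m s A
  have : FiniteDimensional k U := Submodule.finiteDimensional_of_le hUW
  have : FiniteDimensional k P := Submodule.finiteDimensional_of_le hPW
  have hinf : U ⊓ P ≠ ⊥ := by
    intro h
    have h1 := Submodule.finrank_sup_add_finrank_inf_eq U P
    have h2 : finrank k (U ⊔ P : Submodule k 𝒜) ≤ finrank k W :=
      Submodule.finrank_mono (sup_le hUW hPW)
    rw [h, finrank_bot] at h1
    omega
  obtain ⟨a, ⟨⟨v, hv, rfl⟩, N, hN, hNa⟩, ha⟩ := Submodule.exists_mem_ne_zero_of_ne_bot hinf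
  obtain ⟨c, rfl⟩ := exists_wtPoly_of_mem hv
  have hN0 : N ≠ 0 := by
    rintro rfl
    exact ha (by rw [← hNa]; simp)
  refine ⟨N, wtPoly c, hN0, ?_, by simpa using hNa⟩
  have := (natDegree_lt_iff_degree_lt hN0).2 (mem_degreeLT.1 hN)
  omega

end Weights

section BaseChange

theorem irreducible_map_of_algebraicallyClosedIn {k K : Type*} [Field k] [Field K] [Algebra k K]
    (hk : ∀ x : K, IsAlgebraic k x → ∃ c : k, algebraMap k K c = x) {F : k[X][Y]} (hF : F.Monic)
    (hirr : Irreducible F) : Irreducible (F.map (mapRingHom (algebraMap k K))) := by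
  have hinj : Function.Injective (mapRingHom (algebraMap k K)) :=
    map_injective _ (algebraMap k K).injective
  have key : ∀ f : K[X][Y], f.Monic → f ∣ F.map (mapRingHom (algebraMap k K)) →
      ∃ f₀ : k[X][Y], f₀.map (mapRingHom (algebraMap k K)) = f := by
    intro f hf hdvd
    suffices h : f ∈ Set.range (Polynomial.map (mapRingHom (algebraMap k K))) from h
    refine (mem_map_range _).2 fun j => ?_
    suffices h : f.coeff j ∈ Set.range (Polynomial.map (algebraMap k K)) from h
    refine (mem_map_range _).2 fun i => ?_
    let _ : Algebra k[X] K[X] := (mapRingHom (algebraMap k K)).toAlgebra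
    have h1 : IsIntegral k[X] (f.coeff j) := isIntegral_coeff_of_dvd F f hF hf hdvd j
    exact hk _ (h1.coeff i).isAlgebraic
  rw [(hF.map _).irreducible_iff_natDegree]
  refine ⟨fun h => ?_, fun f g hf hg hfg => ?_⟩
  · have : F = 1 := map_injective _ hinj (by rw [h, Polynomial.map_one])
    exact hirr.not_isUnit (this ▸ isUnit_one)
  · obtain ⟨f₀, rfl⟩ := key f hf (Dvd.intro _ hfg)
    obtain ⟨g₀, rfl⟩ := key g hg (Dvd.intro_left _ hfg)
    rw [← Polynomial.map_mul] at hfg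
    have := map_injective _ hinj hfg
    rw [natDegree_map_eq_of_injective hinj, natDegree_map_eq_of_injective hinj]
    exact ((hF.irreducible_iff_natDegree).1 hirr).2 f₀ g₀ (monic_of_injective hinj hf)
      (monic_of_injective hinj hg) this

theorem eq_zero_of_eval_map_iterateFrobenius {K : Type*} [Field K] {p : ℕ} [Fact p.Prime]
    [CharP K p] {x : K} (hx : ∀ z, z ^ p ≠ x) {s : ℕ} {N : K[X]}
    (h : (N.map (iterateFrobenius K p s)).eval x = 0) (hN : N.natDegree < p ^ s) : N = 0 := by
  obtain ⟨ξ, hξ⟩ := IsAlgClosed.exists_pow_nat_eq (algebraMap K (AlgebraicClosure K) x)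
    (pow_pos (Fact.out : p.Prime).pos s)
  have : CharP (AlgebraicClosure K) p := charP_of_injective_algebraMap (algebraMap K _).injective p
  have h0 : aeval ξ N = 0 := by
    have h1 : (aeval ξ N) ^ p ^ s = algebraMap K (AlgebraicClosure K)
        ((N.map (iterateFrobenius K p s)).eval x) := by
      rw [aeval_eq_sum_range, sum_pow_char_pow,
        eval_eq_sum_range' (lt_of_le_of_lt natDegree_map_le (Nat.lt_succ_self _)), map_sum]
      refine Finset.sum_congr rfl fun i _ => ?_
      simp [Algebra.smul_def, mul_pow, ← hξ, iterateFrobenius_def, ← pow_mul, mul_comm]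
    rw [h, map_zero] at h1
    exact pow_eq_zero_iff (pow_pos (Fact.out : p.Prime).pos s).ne' |>.1 h1
  have hmin : (minpoly K ξ).natDegree = p ^ s := by
    obtain ⟨n, y, hy⟩ := (minpoly.natSepDegree_eq_one_iff_eq_X_pow_sub_C p).1
      ((minpoly.natSepDegree_eq_one_iff_pow_mem p).2 ⟨s, x, hξ.symm⟩)
    have hyξ : ξ ^ p ^ n = algebraMap K _ y := by
      have := minpoly.aeval K ξ
      rw [hy] at this
      simpa [sub_eq_zero] using this
    rw [hy, natDegree_X_pow_sub_C]
    have hpn : 0 < p ^ n := pow_pos (Fact.out : p.Prime).pos n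
    rcases lt_trichotomy n s with hn | hn | hn
    · exfalso
      obtain ⟨d, rfl⟩ := Nat.exists_eq_add_of_lt hn
      refine hx (y ^ p ^ d) ((algebraMap K (AlgebraicClosure K)).injective ?_)
      rw [← hξ, map_pow, map_pow, ← hyξ, ← pow_mul, ← pow_mul]
      congr 1
      ring
    · rw [hn]
    · exfalso
      have h1 : minpoly K ξ ∣ X ^ p ^ s - C x := minpoly.dvd _ _ (by simp [hξ])
      have h2 := natDegree_le_of_dvd h1
        (X_pow_sub_C_ne_zero (pow_pos (Fact.out : p.Prime).pos s) x)
      rw [hy, natDegree_X_pow_sub_C, natDegree_X_pow_sub_C] at h2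
      exact absurd h2 (not_le.2 (Nat.pow_lt_pow_right (Fact.out : p.Prime).one_lt hn))
  by_contra hne
  have := natDegree_le_of_dvd (minpoly.dvd K ξ h0) hne
  omega

end BaseChange

section Norm

variable {k 𝒜 : Type*} [Field k] [CommRing 𝒜] [Algebra k 𝒜]

theorem natDegree_pos_of_monic_irreducible {F : k[X][Y]} (hF : F.Monic) (hirr : Irreducible F) :
    0 < F.natDegree := by
  rcases Nat.eq_zero_or_pos F.natDegree with h | h
  · exact absurd ((hF.natDegree_eq_zero.1 h) ▸ isUnit_one) hirr.not_isUnit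
  · exact h

theorem aevalAeval_mem_wtSpan {x y : 𝒜} {F : k[X][Y]} {e : ℕ} (hF : F.Monic)
    (hw : WtBound F e F.natDegree) (h0 : aevalAeval x y F = 0) {P : k[X][Y]} {t : ℕ}
    (hP : ∀ i j, (P.coeff j).coeff i ≠ 0 → i + e * j ≤ t) :
    aevalAeval x y P ∈ wtSpan k x y e F.natDegree t := by
  rw [aevalAeval_eq_sum x y P (Nat.lt_succ_self _)]
  refine Submodule.sum_mem _ fun j _ => ?_
  rw [aeval_eq_sum_range, Finset.sum_mul]
  refine Submodule.sum_mem _ fun i _ => ?_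
  rw [smul_mul_assoc]
  by_cases h : (P.coeff j).coeff i = 0
  · rw [h, zero_smul]
    exact Submodule.zero_mem _
  · exact Submodule.smul_mem _ _ (monomial_mem_wtSpan hF hw h0 (hP i j h))

theorem exists_dvd_mul_sub_C {F : k[X][Y]} {e : ℕ} (hF : F.Monic) (hirr : Irreducible F)
    (hw : WtBound F e F.natDegree) {P : k[X][Y]} (hndvd : ¬ F ∣ P) {t : ℕ}
    (hP : ∀ i j, (P.coeff j).coeff i ≠ 0 → i + e * j ≤ t) :
    ∃ (N : k[X]) (V : k[X][Y]), N ≠ 0 ∧ N.natDegree ≤ F.natDegree * t ∧ F ∣ P * V - C N := by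
  have := AdjoinRoot.isDomain_of_prime hirr.prime
  have hae : ∀ P : k[X][Y], aevalAeval (AdjoinRoot.of F X) (AdjoinRoot.root F) P =
      AdjoinRoot.mk F P := by
    have : aevalAeval (AdjoinRoot.of F X) (AdjoinRoot.root F) =
        (AdjoinRoot.mkₐ (F)).restrictScalars k := by
      refine (aevalAevalEquiv k _).symm.injective ?_
      rw [Equiv.symm_apply_apply]
      rfl
    intro P
    rw [this]
    rfl
  have hker : ∀ P, aevalAeval (AdjoinRoot.of F X) (AdjoinRoot.root F) P = 0 → F ∣ P := by
    intro P hP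
    rwa [hae, AdjoinRoot.mk_eq_zero] at hP
  have h0 : aevalAeval (AdjoinRoot.of F X) (AdjoinRoot.root F) F = 0 := by
    rw [hae, AdjoinRoot.mk_self]
  obtain ⟨N, V, hN, hdeg, hNV⟩ := exists_multiple_eq_aeval hF
    (natDegree_pos_of_monic_irreducible hF hirr) hw h0 hker
    (aevalAeval_mem_wtSpan hF hw h0 hP) (fun h => hndvd (hker P h))
  refine ⟨N, V, hN, hdeg, hker _ ?_⟩
  have h2 := aevalAeval_C (AdjoinRoot.of F X) (AdjoinRoot.root F) N
  rw [map_sub, map_mul, h2, hNV, sub_self]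

theorem add_le_of_coeff_wtPoly_ne_zero {e m t : ℕ} {c : wtIdx e m t → k} {i j : ℕ}
    (h : ((wtPoly c).coeff j).coeff i ≠ 0) : i + e * j ≤ t := by
  by_contra hlt
  refine h ?_
  rw [wtPoly, finsetSum_coeff, finsetSum_coeff]
  refine Finset.sum_eq_zero fun v _ => ?_
  rw [coeff_monomial]
  split_ifs with h1
  · rw [coeff_monomial, if_neg]
    rintro rfl
    exact hlt (h1 ▸ (mem_wtIdx.1 v.2).2)
  · simp

theorem exists_wt (e : ℕ) (P : k[X][Y]) :
    ∃ t, ∀ i j, (P.coeff j).coeff i ≠ 0 → i + e * j ≤ t := by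
  refine ⟨(P.support.sup fun j => (P.coeff j).natDegree) + e * P.natDegree, fun i j h => ?_⟩
  have hj : P.coeff j ≠ 0 := fun h' => h (by simp [h'])
  refine add_le_add ?_ (Nat.mul_le_mul_left _ (le_natDegree_of_ne_zero hj))
  exact (le_natDegree_of_ne_zero h).trans
    (Finset.le_sup (f := fun j => (P.coeff j).natDegree) (mem_support_iff.2 hj))

end Norm

section Nonvanishing

variable {k K : Type*} [Field k] [Field K] [Algebra k K]

/-- A combination `∑ d ^ (p ^ s) * x ^ i * y ^ j` with `i`, `j` small compared with `p ^ s`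
vanishes only when all coefficients do, as soon as `x` is not a `p`-th power. -/
theorem eq_zero_of_sum_pow_mul_eq_zero {p : ℕ} [Fact p.Prime] [CharP K p]
    (hk : ∀ x : K, IsAlgebraic k x → ∃ c : k, algebraMap k K c = x) {x y : K}
    {F : k[X][Y]} {e : ℕ} (hF : F.Monic) (hirr : Irreducible F) (hw : WtBound F e F.natDegree)
    (h0 : aevalAeval x y F = 0) (hx : ∀ z, z ^ p ≠ x) {s A : ℕ} (hs : ∀ c : k, c ^ p ^ s = c)
    (hA : F.natDegree * A < p ^ s) {d : wtIdx e F.natDegree A → K}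
    (hd : ∑ v, d v ^ p ^ s * (x ^ v.1.2 * y ^ v.1.1) = 0) : d = 0 := by
  set F' : K[X][Y] := F.map (mapRingHom (algebraMap k K)) with hF'
  have hdegF' : F'.natDegree = F.natDegree := hF.natDegree_map _
  have hF'm : F'.Monic := hF.map _
  have hw' : WtBound F' e F'.natDegree := by
    intro j hj
    rw [hdegF'] at hj ⊢
    refine le_trans (Nat.add_le_add_right ?_ _) (hw j hj)
    rw [hF', coeff_map]
    exact natDegree_map_le
  by_contra hne
  have hG : ¬ F' ∣ wtPoly d := by
    intro h
    refine hne (eq_zero_of_wtPoly_eq_zero (eq_zero_of_dvd_of_degree_lt h ?_))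
    rw [degree_eq_natDegree hF'm.ne_zero, hdegF']
    exact degree_wtPoly_lt d
  obtain ⟨N, V, hN, hdeg, W, hW⟩ := exists_dvd_mul_sub_C hF'm
    (irreducible_map_of_algebraicallyClosedIn hk hF hirr) hw' hG
    fun _ _ => add_le_of_coeff_wtPoly_ne_zero
  rw [hdegF'] at hdeg
  let φ : K[X][Y] →+* K := (aevalAeval x y : K[X][Y] →ₐ[K] K).toRingHom.comp
    (mapRingHom (mapRingHom (iterateFrobenius K p s)))
  have hφF : φ F' = 0 := by
    have : mapRingHom (mapRingHom (iterateFrobenius K p s)) F' = F' := by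
      rw [hF', coe_mapRingHom, Polynomial.map_map, mapRingHom_comp]
      congr 2
      ext c
      simp [iterateFrobenius_def, ← map_pow, hs]
    change aevalAeval x y (mapRingHom (mapRingHom (iterateFrobenius K p s)) F') = 0
    rw [this, ← h0]
    rw [aevalAeval_eq_sum x y F (Nat.lt_succ_self _),
      aevalAeval_eq_sum x y F' (Nat.lt_succ_self _), hdegF']
    refine Finset.sum_congr rfl fun j _ => ?_
    rw [hF', coeff_map]
    simp
  have hφG : φ (wtPoly d) = 0 := by
    rw [← hd, wtPoly, map_sum]
    refine Finset.sum_congr rfl fun v _ => ?_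
    change aevalAeval x y (mapRingHom (mapRingHom (iterateFrobenius K p s)) _) = _
    rw [coe_mapRingHom, map_monomial, coe_mapRingHom, map_monomial,
      ← C_mul_X_pow_eq_monomial, ← C_mul_X_pow_eq_monomial, map_mul, map_pow]
    simp [iterateFrobenius_def, mul_assoc]
  have hφN : φ (C N) = (N.map (iterateFrobenius K p s)).eval x := by
    change aevalAeval x y (mapRingHom (mapRingHom (iterateFrobenius K p s)) _) = _
    rw [coe_mapRingHom, map_C, aevalAeval_C, coe_mapRingHom, coe_aeval_eq_eval]
  refine hN (eq_zero_of_eval_map_iterateFrobenius hx ?_ (lt_of_le_of_lt hdeg hA))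
  rw [← hφN]
  have := congrArg φ hW
  rw [map_sub, map_mul, map_mul, hφF, hφG, zero_mul, zero_mul, zero_sub, neg_eq_zero] at this
  exact this

end Nonvanishing

section ThreeVariables

variable {k 𝒜 : Type*} [Field k] [CommRing 𝒜] [Algebra k 𝒜]

theorem pow_mem_of_divided_difference {x y z : 𝒜} {F : k[X][Y]} {e : ℕ} (hF : F.Monic)
    (hm : 0 < F.natDegree) (hw : WtBound F e F.natDegree)
    (h0 : ∑ j ∈ Finset.range (F.natDegree + 1), aeval x (F.coeff j) *
      ∑ i ∈ Finset.range j, z ^ i * y ^ (j - 1 - i) = 0) :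
    z ^ (F.natDegree - 1) ∈ Submodule.span k {w | ∃ i j l, l < F.natDegree - 1 ∧
      i + e * (j + l) ≤ e * (F.natDegree - 1) ∧ w = x ^ i * y ^ j * z ^ l} := by
  obtain ⟨m, hm'⟩ := Nat.exists_eq_add_of_lt hm
  rw [zero_add] at hm'
  rw [Finset.sum_range_succ, coeff_natDegree, hF.leadingCoeff, map_one, one_mul] at h0
  rw [hm'] at h0 hw ⊢
  rw [Finset.sum_range_succ (fun i => z ^ i * y ^ (m + 1 - 1 - i)), ← add_assoc] at h0
  have h1 : z ^ (m + 1 - 1) = - (∑ j ∈ Finset.range (m + 1), aeval x (F.coeff j) *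
      ∑ i ∈ Finset.range j, z ^ i * y ^ (j - 1 - i) +
      ∑ i ∈ Finset.range m, z ^ i * y ^ (m + 1 - 1 - i)) := by
    rw [neg_eq_of_add_eq_zero_right h0]
    simp
  rw [h1]
  refine neg_mem (add_mem (sum_mem fun j hj => ?_) (sum_mem fun i hi => ?_))
  · rw [aeval_eq_sum_range, Finset.sum_mul]
    refine sum_mem fun a ha => ?_
    rw [Finset.mul_sum]
    refine sum_mem fun i hi => ?_
    rw [Algebra.smul_mul_assoc]
    simp only [Finset.mem_range] at hj ha hi
    have h2 := hw j (by omega)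
    refine Submodule.smul_mem _ _ (Submodule.subset_span
      ⟨a, j - 1 - i, i, by omega, ?_, by ring⟩)
    obtain ⟨j, rfl⟩ := Nat.exists_eq_add_of_lt hi
    rw [show i + j + 1 - 1 - i + i = i + j by omega]
    have h3 : e * (i + j + 1) = e * (i + j) + e := by ring
    have h4 : e * (m + 1) = e * m + e := by ring
    simp only [Nat.add_sub_cancel]
    omega
  · rw [Finset.mem_range] at hi
    refine Submodule.subset_span ⟨0, m - i, i, by omega, ?_, by simp; ring⟩
    rw [show m - i + i = m by omega]
    simp

theorem monomial_mem_span_three {x y z : 𝒜} {F : k[X][Y]} {e : ℕ} (hF : F.Monic)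
    (hw : WtBound F e F.natDegree) (h0 : aevalAeval x y F = 0) {m' : ℕ}
    (hz : z ^ m' ∈ Submodule.span k
      {w | ∃ i j l, l < m' ∧ i + e * (j + l) ≤ e * m' ∧ w = x ^ i * y ^ j * z ^ l})
    {l i j t : ℕ} (h : i + e * (j + l) ≤ t) :
    x ^ i * y ^ j * z ^ l ∈ Submodule.span k (Set.range
      fun p : Fin (t + 1) × Fin F.natDegree × Fin m' => x ^ p.1.1 * y ^ p.2.1.1 * z ^ p.2.2.1) := by
  refine Submodule.span_le.2 ?_ (monomial_mem_span_of_relation hz l i j t h)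
  rintro w ⟨i, j, l, hl, hw', rfl⟩
  have h1 := monomial_mem_wtSpan hF hw h0 (i := i) (j := j) (t := t)
    (by rw [mul_add] at hw'; omega)
  have h2 := Submodule.mem_map_of_mem (f := LinearMap.mulRight k (z ^ l)) h1
  rw [wtSpan, Submodule.map_span] at h2
  refine Submodule.span_mono ?_ h2
  rintro _ ⟨_, ⟨p, rfl⟩, rfl⟩
  have hp := mem_wtIdx.1 p.2
  exact ⟨⟨⟨p.1.2, by omega⟩, ⟨p.1.1, hp.1⟩, ⟨l, hl⟩⟩, rfl⟩

end ThreeVariables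

section Stepanov

variable {k K Ω : Type*} [Field k] [Field K] [Algebra k K] [Field Ω] [Algebra k Ω]

theorem aeval_pi_apply {S : Type*} (x : S → Ω) (P : k[X]) (s : S) :
    aeval x P s = aeval (x s) P := by
  have := aeval_algHom_apply (Pi.evalAlgHom k (fun _ : S => Ω) s) x P
  exact this.symm

theorem aevalAeval_algHom_apply {A B : Type*} [CommRing A] [Algebra k A] [CommRing B] [Algebra k B]
    (f : A →ₐ[k] B) (x y : A) (P : k[X][Y]) :
    aevalAeval (f x) (f y) P = f (aevalAeval x y P) := by
  rw [aevalAeval_eq_sum _ _ P (Nat.lt_succ_self _), aevalAeval_eq_sum _ _ P (Nat.lt_succ_self _),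
    map_sum]
  simp [aeval_algHom_apply]

theorem aevalAeval_eq_eval_map {A : Type*} [CommRing A] [Algebra k A] (x y : A) (P : k[X][Y]) :
    aevalAeval x y P = (P.map (aeval x : k[X] →ₐ[k] A).toRingHom).eval y := by
  rw [aevalAeval_eq_sum _ _ P (Nat.lt_succ_self _),
    eval_eq_sum_range' (lt_of_le_of_lt natDegree_map_le (Nat.lt_succ_self _))]
  simp

theorem aevalAeval_pow {p n : ℕ} [Fact p.Prime] [CharP Ω p] (hn : ∀ c : k, c ^ p ^ n = c)
    (x y : Ω) (P : k[X][Y]) :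
    aevalAeval (x ^ p ^ n) (y ^ p ^ n) P = aevalAeval x y P ^ p ^ n := by
  let φ : Ω →ₐ[k] Ω := { iterateFrobenius Ω p n with
    commutes' := fun c => by
      change iterateFrobenius Ω p n _ = _
      rw [iterateFrobenius_def, ← map_pow, hn] }
  exact aevalAeval_algHom_apply φ x y P

theorem aevalAeval_sum_monomial {𝒜 ι : Type*} [CommRing 𝒜] [Algebra k 𝒜] [Fintype ι] (x y : 𝒜)
    (c : ι → k) (i j : ι → ℕ) :
    aevalAeval x y (∑ a, monomial (j a) (monomial (i a) (c a)) : k[X][Y]) =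
      ∑ a, c a • (x ^ i a * y ^ j a) := by
  rw [map_sum]
  refine Finset.sum_congr rfl fun a _ => ?_
  rw [← C_mul_X_pow_eq_monomial, ← C_mul_X_pow_eq_monomial, map_mul, map_pow]
  simp [Algebra.smul_def, mul_assoc]

theorem eq_zero_of_sum_smul_monomials_eq_zero {𝒜 : Type*} [CommRing 𝒜] [Algebra k 𝒜] {x y : 𝒜}
    {F : k[X][Y]} (hF : F.Monic)
    (hker : ∀ P, aevalAeval x y P = 0 → F ∣ P) {e t : ℕ} {c : wtIdx e F.natDegree t → k}
    (hc : ∑ u, c u • (x ^ u.1.2 * y ^ u.1.1) = 0) : c = 0 := by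
  rw [← aevalAeval_wtPoly] at hc
  refine eq_zero_of_wtPoly_eq_zero (eq_zero_of_dvd_of_degree_lt (hker _ hc) ?_)
  rw [degree_eq_natDegree hF.ne_zero]
  exact degree_wtPoly_lt c

/-- Stepanov's method, in Bombieri's form: the number of points of a finite set of abscissae all of
whose `F`-ordinates lie outside the field with `p ^ a * p ^ s` elements is small. -/
theorem card_le_of_forall_ordinate_pow_ne {p : ℕ} [Fact p.Prime] [CharP K p] [CharP Ω p]
    (hk : ∀ x : K, IsAlgebraic k x → ∃ c : k, algebraMap k K c = x) {x y : K}
    {F : k[X][Y]} {e : ℕ} (hF : F.Monic) (hirr : Irreducible F) (hw : WtBound F e F.natDegree)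
    (h0 : aevalAeval x y F = 0) (hker : ∀ P, aevalAeval x y P = 0 → F ∣ P)
    (hx : ∀ z, z ^ p ≠ x) {a s A B : ℕ}
    (ha : ∀ c : k, c ^ p ^ a = c) (hs : ∀ c : k, c ^ p ^ s = c)
    (hA : F.natDegree * A < p ^ s)
    (hAB : (p ^ a * A + B + 1) * (F.natDegree * (F.natDegree - 1)) <
      (wtIdx e F.natDegree A).card * (wtIdx e F.natDegree B).card)
    (G : Finset Ω) (hG : ∀ α ∈ G, α ^ (p ^ a * p ^ s) = α)
    (hroots : ∀ α ∈ G, ∃ R : Finset Ω, R.card = F.natDegree ∧ ∀ β ∈ R, aevalAeval α β F = 0)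
    (hno : ∀ α ∈ G, ∀ β, aevalAeval α β F = 0 → β ^ (p ^ a * p ^ s) ≠ β) :
    G.card ≤ A + p ^ s * B := by
  classical
  by_contra! hcard
  set m := F.natDegree with hmdef
  have hm : 0 < m := natDegree_pos_of_monic_irreducible hF hirr
  let S := {q : Ω × Ω // q.1 ∈ G ∧ aevalAeval q.1 q.2 F = 0}
  let u : S → Ω := fun q => q.1.1
  let v : S → Ω := fun q => q.1.2
  let w : S → Ω := fun q => q.1.2 ^ (p ^ a * p ^ s)
  have hev : ∀ (P : k[X][Y]) (q : S), aevalAeval u v P q = aevalAeval q.1.1 q.1.2 P := fun P q =>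
    (aevalAeval_algHom_apply (Pi.evalAlgHom k (fun _ : S => Ω) q) u v P).symm
  have hFuv : aevalAeval u v F = 0 := by
    funext q
    rw [hev, q.2.2]
    rfl
  have hrel : ∑ j ∈ Finset.range (F.natDegree + 1), aeval u (F.coeff j) *
      ∑ i ∈ Finset.range j, w ^ i * v ^ (j - 1 - i) = 0 := by
    funext q
    have hne : w q - v q ≠ 0 := sub_ne_zero.2 (hno _ q.2.1 _ q.2.2)
    refine (mul_eq_zero_iff_right hne).1 ?_
    have h1 : aevalAeval q.1.1 (w q) F = 0 := by
      have hn : ∀ c : k, c ^ p ^ (a + s) = c := fun c => by rw [pow_add, pow_mul, ha, hs]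
      have := aevalAeval_pow hn q.1.1 q.1.2 F
      rw [q.2.2, pow_add, zero_pow (by simp [(Fact.out : p.Prime).ne_zero]), hG _ q.2.1] at this
      exact this
    have h2 := q.2.2
    rw [aevalAeval_eq_sum _ _ F (Nat.lt_succ_self _)] at h1 h2
    rw [Finset.sum_apply, Finset.sum_mul]
    trans (∑ j ∈ Finset.range (F.natDegree + 1), aeval q.1.1 (F.coeff j) * (w q) ^ j) -
      ∑ j ∈ Finset.range (F.natDegree + 1), aeval q.1.1 (F.coeff j) * q.1.2 ^ j
    · rw [← Finset.sum_sub_distrib]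
      refine Finset.sum_congr rfl fun j _ => ?_
      rw [← mul_sub, ← geom_sum₂_mul, Pi.mul_apply, aeval_pi_apply, Finset.sum_apply, mul_assoc]
      rfl
    · rw [h1, h2, sub_zero]
  have hz := pow_mem_of_divided_difference hF hm hw hrel
  rw [← hmdef] at hz
  let f : wtIdx e m A × wtIdx e m B → (S → Ω) := fun i =>
    u ^ (p ^ a * i.1.1.2 + i.2.1.2) * v ^ (p ^ a * i.1.1.1) * w ^ i.2.1.1
  let T : Submodule k (S → Ω) := Submodule.span k (Set.range
    fun i : Fin (p ^ a * A + B + 1) × Fin m × Fin (m - 1) =>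
      u ^ i.1.1 * v ^ i.2.1.1 * w ^ i.2.2.1)
  have : FiniteDimensional k T := FiniteDimensional.span_of_finite k (Set.finite_range _)
  have hT : finrank k T ≤ (p ^ a * A + B + 1) * (m * (m - 1)) := by
    refine (finrank_range_le_card _).trans ?_
    simp
  have hfT : ∀ i, f i ∈ T := by
    intro i
    refine monomial_mem_span_three hF hw hFuv hz ?_
    have h1 := (mem_wtIdx.1 i.1.2).2
    have h2 := (mem_wtIdx.1 i.2.2).2
    have h3 := Nat.mul_le_mul_left (p ^ a) h1
    calc _ = p ^ a * (i.1.1.2 + e * i.1.1.1) + (i.2.1.2 + e * i.2.1.1) := by ring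
      _ ≤ _ := add_le_add h3 h2
  obtain ⟨c, hc, hc0⟩ : ∃ c : wtIdx e m A × wtIdx e m B → k, ∑ i, c i • f i = 0 ∧ c ≠ 0 := by
    let Φ : (wtIdx e m A × wtIdx e m B → k) →ₗ[k] T :=
      Fintype.linearCombination k fun i => (⟨f i, hfT i⟩ : T)
    have := LinearMap.ker_ne_bot_of_finrank_lt (f := Φ) (by
      refine lt_of_le_of_lt hT (lt_of_lt_of_eq hAB ?_)
      simp)
    obtain ⟨c, hc, hc0⟩ := (Submodule.ne_bot_iff _).1 this
    refine ⟨c, ?_, hc0⟩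
    have := congrArg T.subtype (LinearMap.mem_ker.1 hc)
    simpa [Φ, Fintype.linearCombination_apply] using this
  let H : k[X][Y] := ∑ i : wtIdx e m A × wtIdx e m B, monomial (i.1.1.1 + p ^ s * i.2.1.1)
    (monomial (i.1.1.2 + p ^ s * i.2.1.2) (c i))
  have hHS : ∀ q : S, aevalAeval q.1.1 q.1.2 H = 0 := by
    intro q
    refine eq_zero_of_pow_eq_zero (n := p ^ a) ?_
    rw [aevalAeval_sum_monomial, sum_pow_char_pow]
    have h1 := congrFun hc q
    rw [Finset.sum_apply] at h1
    refine Eq.trans ?_ h1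
    refine Finset.sum_congr rfl fun i _ => ?_
    simp only [f, Pi.smul_apply, Pi.mul_apply, Pi.pow_apply, Algebra.smul_def]
    rw [mul_pow, ← map_pow, ha]
    congr 1
    have h2 : u q ^ (p ^ a * i.1.1.2 + i.2.1.2) =
        u q ^ (p ^ a * i.1.1.2) * (u q ^ (p ^ a * p ^ s)) ^ i.2.1.2 := by
      rw [hG _ q.2.1, pow_add]
    rw [h2]
    simp only [u, v, w]
    ring
  obtain ⟨c', hc'⟩ := exists_wtPoly_of_mem
    (aevalAeval_mem_wtSpan hF hw h0 (P := H) (t := A + p ^ s * B) (by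
      intro i j h
      by_contra hlt
      refine h ?_
      rw [finsetSum_coeff, finsetSum_coeff]
      refine Finset.sum_eq_zero fun q _ => ?_
      rw [coeff_monomial]
      split_ifs with h1
      · rw [coeff_monomial, if_neg]
        rintro rfl
        refine hlt ?_
        rw [← h1]
        have h1 := (mem_wtIdx.1 q.1.2).2
        have h2 := Nat.mul_le_mul_left (p ^ s) (mem_wtIdx.1 q.2.2).2
        linarith
      · simp))
  have hc'0 : wtPoly c' = 0 := by
    have hP : ∀ q : S, aevalAeval q.1.1 q.1.2 (wtPoly c') = 0 := by
      intro q
      obtain ⟨V, hV⟩ := hker (H - wtPoly c') (by rw [map_sub, hc', sub_self])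
      have := congrArg (aevalAeval q.1.1 q.1.2) hV
      rwa [map_sub, map_mul, q.2.2, zero_mul, hHS, zero_sub, neg_eq_zero] at this
    ext1 j
    rw [coeff_zero]
    refine (map_eq_zero_iff (mapRingHom (algebraMap k Ω))
      (map_injective _ (algebraMap k Ω).injective)).1 ?_
    refine eq_zero_of_natDegree_lt_card_of_eval_eq_zero' _ G (fun α hα => ?_) ?_
    · rw [coe_mapRingHom, eval_map_algebraMap]
      obtain ⟨R, hR, hRF⟩ := hroots α hα
      have h1 : (wtPoly c').map (aeval α : k[X] →ₐ[k] Ω).toRingHom = 0 := by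
        refine eq_zero_of_degree_lt_of_eval_finset_eq_zero R ?_ fun β hβ => ?_
        · rw [hR]
          exact lt_of_le_of_lt degree_map_le (degree_wtPoly_lt c')
        · rw [← aevalAeval_eq_eval_map]
          exact hP ⟨(α, β), hα, hRF β hβ⟩
      have h2 := congrArg (fun P => coeff P j) h1
      simpa using h2
    · rw [coe_mapRingHom]
      exact lt_of_le_of_lt (natDegree_map_le.trans (natDegree_coeff_wtPoly_le c' j)) hcard
  rw [hc'0, map_zero, aevalAeval_sum_monomial, Fintype.sum_prod_type] at hc'
  have hd := eq_zero_of_sum_pow_mul_eq_zero hk hF hirr hw h0 hx hs hA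
    (d := fun v => ∑ u, c (v, u) • (x ^ u.1.2 * y ^ u.1.1)) (by
      rw [← hc'.symm]
      refine Finset.sum_congr rfl fun i _ => ?_
      rw [sum_pow_char_pow, Finset.sum_mul]
      refine Finset.sum_congr rfl fun l _ => ?_
      rw [Algebra.smul_def, Algebra.smul_def, mul_pow, ← map_pow, hs]
      ring)
  exact hc0 (funext fun i => congrFun (eq_zero_of_sum_smul_monomials_eq_zero hF hker
    (c := fun u => c (i.1, u)) (congrFun hd i.1)) i.2)

end Stepanov

section Discriminant

variable {k Ω : Type*} [Field k] [Field Ω] [Algebra k Ω]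

theorem exists_discriminant {F : k[X][Y]} {e : ℕ} (hF : F.Monic)
    (hirr : Irreducible F) (hw : WtBound F e F.natDegree) (hsep : derivative F ≠ 0) :
    ∃ N : k[X], N ≠ 0 ∧ N.natDegree ≤ F.natDegree * (e * (F.natDegree - 1)) ∧
      ∃ V : k[X][Y], F ∣ derivative F * V - C N := by
  obtain ⟨N, V, h1, h2, h3⟩ := exists_dvd_mul_sub_C hF hirr hw (P := derivative F)
    (t := e * (F.natDegree - 1))
    (fun h => hsep (eq_zero_of_dvd_of_natDegree_lt h (natDegree_derivative_lt
      (natDegree_pos_of_monic_irreducible hF hirr).ne'))) (fun i j h => by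
      rw [coeff_derivative] at h
      have hne : (F.coeff (j + 1)).coeff i ≠ 0 := by
        intro h'
        refine h ?_
        rw [← Nat.cast_succ, mul_comm, ← nsmul_eq_mul, coeff_smul, h', smul_zero]
      have hj : j + 1 ≤ F.natDegree := le_natDegree_of_ne_zero (fun h' => hne (by simp [h']))
      have h2 := hw (j + 1) hj
      have h3 := le_natDegree_of_ne_zero hne
      obtain ⟨m, hm⟩ := Nat.exists_eq_add_of_le' (le_trans (Nat.le_add_left 1 j) hj)
      rw [hm] at h2 ⊢
      rw [mul_add, mul_add] at h2
      rw [Nat.add_sub_cancel]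
      omega)
  exact ⟨N, h1, h2, V, h3⟩

theorem derivative_ne_zero_of_discriminant {F V : k[X][Y]} {N : k[X]}
    (h : F ∣ derivative F * V - C N) {α β : Ω} (hα : aeval α N ≠ 0)
    (hβ : aevalAeval α β F = 0) : aevalAeval α β (derivative F) ≠ 0 := by
  intro h'
  obtain ⟨W, hW⟩ := h
  have := congrArg (aevalAeval α β) hW
  rw [map_sub, map_mul, map_mul, hβ, h', zero_mul, zero_mul, zero_sub, neg_eq_zero,
    aevalAeval_C] at this
  exact hα this

theorem exists_roots_of_discriminant [IsAlgClosed Ω] {F V : k[X][Y]} (hF : F.Monic) {N : k[X]}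
    (h : F ∣ derivative F * V - C N) {α : Ω} (hα : aeval α N ≠ 0) :
    ∃ R : Finset Ω, R.card = F.natDegree ∧ ∀ β ∈ R, aevalAeval α β F = 0 := by
  classical
  set f := F.map (aeval α : k[X] →ₐ[k] Ω).toRingHom with hf
  have hfm : f.Monic := hF.map _
  have hnodup : f.roots.Nodup := by
    rw [Multiset.nodup_iff_count_le_one]
    intro β
    rw [count_roots]
    by_contra! hlt
    have hr : f.IsRoot β := by
      rw [← rootMultiplicity_pos hfm.ne_zero]
      omega
    have h2 := (one_lt_rootMultiplicity_iff_isRoot hfm.ne_zero).1 hlt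
    refine derivative_ne_zero_of_discriminant h hα (β := β) ?_ ?_
    · rw [aevalAeval_eq_eval_map]
      exact hr
    · rw [aevalAeval_eq_eval_map, ← derivative_map]
      exact h2.2
  refine ⟨f.roots.toFinset, ?_, fun β hβ => ?_⟩
  · rw [Multiset.toFinset_card_of_nodup hnodup, ← hF.natDegree_map (aeval α : k[X] →ₐ[k] Ω).toRingHom,
      ← (IsAlgClosed.splits f).natDegree_eq_card_roots]
  · rw [Multiset.mem_toFinset, mem_roots hfm.ne_zero] at hβ
    rw [aevalAeval_eq_eval_map]
    exact hβ

end Discriminant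

section Abscissae

variable {k Ω : Type*} [Field k] [Field Ω] [Algebra k Ω]

theorem sum_pow_Icc_le {q : ℕ} (hq : 2 ≤ q) (h : ℕ) : ∑ d ∈ Finset.Icc 1 h, q ^ d ≤ 2 * q ^ h := by
  induction h with
  | zero => simp
  | succ h ih =>
    rw [Finset.sum_Icc_succ_top (by omega), pow_succ]
    nlinarith [pow_pos (show 0 < q by omega) h]

theorem exists_finset_generators [IsAlgClosed Ω] [Finite k] {n : ℕ} (hn : 0 < n) {N : k[X]}
    (hN : N ≠ 0) :
    ∃ G : Finset Ω, Nat.card k ^ n ≤ G.card + 2 * Nat.card k ^ (n / 2) + N.natDegree ∧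
      ∀ α ∈ G, α ^ Nat.card k ^ n = α ∧ aeval α N ≠ 0 ∧
        ∀ d, 1 ≤ d → d ≤ n / 2 → α ^ Nat.card k ^ d ≠ α := by
  classical
  have := Fintype.ofFinite k
  set q := Nat.card k with hqdef
  have hq : 2 ≤ q := Finite.one_lt_card
  obtain ⟨p, hp⟩ := CharP.exists k
  have hpp : Fact p.Prime := ⟨CharP.char_is_prime k p⟩
  have : CharP Ω p := charP_of_injective_algebraMap (algebraMap k Ω).injective p
  have hpq : p ∣ q := by
    rw [hqdef, Nat.card_eq_fintype_card]
    exact (CharP.cast_eq_zero_iff k p _).1 (by simp)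
  have hQ : 1 < q ^ n := Nat.one_lt_pow hn.ne' hq
  have hdeg : (X ^ q ^ n - X : Polynomial Ω).natDegree = q ^ n := FiniteField.X_pow_card_sub_X_natDegree_eq Ω hQ
  have hcard : (X ^ q ^ n - X : Polynomial Ω).roots.toFinset.card = q ^ n := by
    rw [Multiset.toFinset_card_of_nodup, ← (IsAlgClosed.splits _).natDegree_eq_card_roots, hdeg]
    exact nodup_roots (galois_poly_separable p _ (dvd_pow hpq hn.ne'))
  let bad : Finset Ω := (Finset.Icc 1 (n / 2)).biUnion fun d => (X ^ q ^ d - X : Polynomial Ω).roots.toFinset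
  have hbad : bad.card ≤ 2 * q ^ (n / 2) := by
    refine Finset.card_biUnion_le.trans (le_trans (Finset.sum_le_sum fun d hd => ?_)
      (sum_pow_Icc_le hq _))
    refine (Multiset.toFinset_card_le _).trans ((card_roots' _).trans (le_of_eq ?_))
    exact FiniteField.X_pow_card_sub_X_natDegree_eq Ω
      (Nat.one_lt_pow (by have := (Finset.mem_Icc.1 hd).1; omega) hq)
  let bad' : Finset Ω := (N.map (algebraMap k Ω)).roots.toFinset
  have hbad' : bad'.card ≤ N.natDegree :=
    (Multiset.toFinset_card_le _).trans ((card_roots' _).trans natDegree_map_le)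
  refine ⟨((X ^ q ^ n - X : Polynomial Ω).roots.toFinset \ bad) \ bad', ?_, fun α hα => ?_⟩
  · have h1 := Finset.le_card_sdiff bad (X ^ q ^ n - X : Polynomial Ω).roots.toFinset
    have h2 := Finset.le_card_sdiff bad' ((X ^ q ^ n - X : Polynomial Ω).roots.toFinset \ bad)
    omega
  · rw [Finset.mem_sdiff, Finset.mem_sdiff] at hα
    obtain ⟨⟨h1, h2⟩, h3⟩ := hα
    refine ⟨?_, fun h => h3 ?_, fun d hd hd' h => h2 ?_⟩
    · rw [Multiset.mem_toFinset] at h1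
      have := isRoot_of_mem_roots h1
      simpa [sub_eq_zero] using this
    · rw [Multiset.mem_toFinset, mem_roots (map_ne_zero hN), IsRoot, eval_map_algebraMap, h]
    · rw [Finset.mem_biUnion]
      refine ⟨d, Finset.mem_Icc.2 ⟨hd, hd'⟩, ?_⟩
      rw [Multiset.mem_toFinset, mem_roots (FiniteField.X_pow_card_sub_X_ne_zero Ω
        (Nat.one_lt_pow (by omega) hq))]
      simp [h]

end Abscissae

section Points

variable {k K Ω : Type*} [Field k] [Field K] [Algebra k K] [Field Ω] [Algebra k Ω]

theorem stepanov_numerics {m w M r A a : ℕ} (hm : 2 ≤ m) (ha : r ≤ m * a) (haA : a = A + 1)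
    (hM : 2 * m * (2 + w) ≤ M) (hr : 2 * m ^ 2 * w ≤ r) :
    (M * A + (M - 3) + 1) * (m * (m - 1)) < (m * (A + 1 - w)) * (m * (M - 3 + 1 - w)) := by
  obtain ⟨b, rfl⟩ := Nat.exists_eq_add_of_le' (show 1 ≤ m by omega)
  have h1 : 2 * (b + 1) * w ≤ a := by
    have : (b + 1) * (2 * (b + 1) * w) ≤ (b + 1) * a := by
      refine le_trans ?_ ha
      refine le_trans (le_of_eq ?_) hr
      ring
    exact Nat.le_of_mul_le_mul_left this (Nat.succ_pos b)
  have hwa : w ≤ a := by nlinarith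
  have hwM : 3 + w ≤ M := by nlinarith
  obtain ⟨c, rfl⟩ := Nat.exists_eq_add_of_le hwa
  obtain ⟨d, rfl⟩ := Nat.exists_eq_add_of_le hwM
  rw [← haA, show w + c - w = c by omega, show 3 + w + d - 3 + 1 - w = d + 1 by omega,
    show 3 + w + d - 3 = w + d by omega, Nat.add_sub_cancel]
  obtain rfl : A = w + c - 1 := by omega
  obtain ⟨f, hf⟩ := Nat.exists_eq_add_of_le' (show 1 ≤ w + c by omega)
  have h2 : (3 + w + d) * (w + c - 1) + (w + d + 1) + 2 = (3 + w + d) * (w + c) := by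
    rw [hf, Nat.add_sub_cancel]
    ring
  have key : b * ((3 + w + d) * (w + c)) ≤ (b + 1) * (c * (d + 1)) := by
    zify at *
    nlinarith
  have : ((3 + w + d) * (w + c - 1) + (w + d + 1)) * b < (b + 1) * (c * (d + 1)) := by
    nlinarith
  calc _ = (b + 1) * (((3 + w + d) * (w + c - 1) + (w + d + 1)) * b) := by ring
    _ < (b + 1) * ((b + 1) * (c * (d + 1))) := Nat.mul_lt_mul_of_pos_left this (Nat.succ_pos b)
    _ = _ := by ring

/-- A curve has a point with coordinates in the field with `q ^ n` elements and whose abscissa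
generates that field, provided `q ^ n` is large compared with the weight of the equation. -/
theorem exists_point [Finite k] [IsAlgClosed Ω] {p : ℕ} [Fact p.Prime] [CharP k p]
    (hk : ∀ x : K, IsAlgebraic k x → ∃ c : k, algebraMap k K c = x) {x y : K}
    {F : k[X][Y]} {e : ℕ} (he : 1 ≤ e) (hF : F.Monic) (hirr : Irreducible F)
    (hw : WtBound F e F.natDegree)
    (h0 : aevalAeval x y F = 0) (hker : ∀ P, aevalAeval x y P = 0 → F ∣ P)
    (hx : ∀ z, z ^ p ≠ x) (hsep : derivative F ≠ 0) {n : ℕ} (hn : 0 < n)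
    (hnum : (F.natDegree = 1 ∧ 3 ≤ Nat.card k ^ (n - n / 2)) ∨ (2 ≤ F.natDegree ∧
      2 * F.natDegree * (2 + e * (F.natDegree - 1)) ≤ Nat.card k ^ (n / 2) ∧
      2 * F.natDegree ^ 2 * (e * (F.natDegree - 1)) ≤ Nat.card k ^ (n - n / 2))) :
    ∃ α β : Ω, α ^ Nat.card k ^ n = α ∧ (∀ d, 1 ≤ d → d ≤ n / 2 → α ^ Nat.card k ^ d ≠ α) ∧
      β ^ Nat.card k ^ n = β ∧ aevalAeval α β F = 0 ∧ aevalAeval α β (derivative F) ≠ 0 := by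
  classical
  obtain ⟨N, hN, hdeg, V, hV⟩ := exists_discriminant hF hirr hw hsep
  obtain ⟨G, hGcard, hG⟩ := exists_finset_generators (k := k) (Ω := Ω) hn hN
  by_contra! hcon
  have : CharP Ω p := charP_of_injective_algebraMap (algebraMap k Ω).injective p
  have : CharP K p := charP_of_injective_algebraMap (algebraMap k K).injective p
  have := Fintype.ofFinite k
  set q := Nat.card k with hqdef
  have hq : 2 ≤ q := Finite.one_lt_card
  obtain ⟨f, -, hf⟩ := FiniteField.card k p
  have hqf : q = p ^ (f : ℕ) := by rw [hqdef, Nat.card_eq_fintype_card, hf]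
  have hkq : ∀ (j : ℕ) (c : k), c ^ q ^ j = c := fun j c => by
    rw [hqdef, Nat.card_eq_fintype_card]
    exact FiniteField.pow_card_pow j c
  have hQ : q ^ n = q ^ (n / 2) * q ^ (n - n / 2) := by
    rw [← pow_add]
    congr 1
    omega
  have hno : ∀ α ∈ G, ∀ β, aevalAeval α β F = 0 → β ^ q ^ n ≠ β := by
    intro α hα β hβ h
    obtain ⟨h1, h2, h3⟩ := hG α hα
    exact derivative_ne_zero_of_discriminant hV h2 hβ (hcon α β h1 h3 h hβ)
  have hMpos : 0 < q ^ (n / 2) := pow_pos (by omega) _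
  rcases hnum with ⟨hm, hr⟩ | ⟨hm, hM, hr⟩
  · rw [hm] at hdeg
    have hpos : 0 < G.card := by
      have : q ^ (n / 2) * 3 ≤ q ^ n := hQ ▸ Nat.mul_le_mul_left _ hr
      simp only [le_refl, tsub_eq_zero_of_le, mul_zero, nonpos_iff_eq_zero] at hdeg
      omega
    obtain ⟨α, hα⟩ := Finset.card_pos.1 hpos
    have hlin : ∀ a b : Ω, aevalAeval a b F = aeval a (F.coeff 0) + b := by
      intro a b
      rw [aevalAeval_eq_sum a b F (Nat.lt_succ_self _), hm, Finset.sum_range_succ,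
        Finset.sum_range_one, ← hm, coeff_natDegree, hF.leadingCoeff, hm]
      simp
    have h1 : aevalAeval α (-aeval α (F.coeff 0)) F = 0 := by rw [hlin, add_neg_cancel]
    refine hno α hα _ h1 ?_
    have h2 := aevalAeval_pow (p := p) (n := f * n) (k := k)
      (by rw [pow_mul, ← hqf]; exact hkq n) α (-aeval α (F.coeff 0)) F
    rw [h1, pow_mul, ← hqf, (hG α hα).1, zero_pow (pow_pos (by omega) _).ne', hlin] at h2
    exact (neg_eq_of_add_eq_zero_right h2).symm
  · set m := F.natDegree with hmdef
    set w := e * (m - 1) with hwdef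
    set M := q ^ (n / 2) with hMdef
    set r := q ^ (n - n / 2) with hrdef
    have hMr : M ≤ r := Nat.pow_le_pow_right (by omega) (by omega)
    have hr1 : 1 ≤ r := by omega
    have hA1 := Nat.div_mul_le_self (r - 1) m
    have hA2 := Nat.lt_div_mul_add (a := r - 1) (b := m) (by omega)
    set A := (r - 1) / m with hAdef
    have hAr : m * A < r := by rw [mul_comm]; omega
    have hw1 : 1 ≤ w := Nat.mul_pos he (by omega)
    have hle := card_le_of_forall_ordinate_pow_ne (a := f * (n / 2)) (s := f * (n - n / 2)) (A := A)
      (B := M - 3) (p := p) (Ω := Ω)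
      hk hF hirr hw h0 hker hx (by rw [pow_mul, ← hqf]; exact hkq _)
      (by rw [pow_mul, ← hqf]; exact hkq _) (by rw [pow_mul, ← hqf]; exact hAr)
      (by
        rw [pow_mul, ← hqf]
        refine lt_of_lt_of_le (stepanov_numerics (r := r) (a := A + 1) hm ?_ rfl hM hr)
          (Nat.mul_le_mul (le_card_wtIdx _ _ _) (le_card_wtIdx _ _ _))
        rw [mul_add, mul_comm m A]
        omega)
      G (by
        rw [pow_mul, ← hqf, pow_mul, ← hqf, ← hMdef, ← hrdef, ← hQ]
        exact fun α hα => (hG α hα).1)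
      (fun α hα => exists_roots_of_discriminant hF hV (hG α hα).2.1)
      (by
        rw [pow_mul, ← hqf, pow_mul, ← hqf, ← hMdef, ← hrdef, ← hQ]
        exact hno)
    rw [pow_mul, ← hqf, ← hrdef] at hle
    have hM3 : 3 ≤ M := by nlinarith
    obtain ⟨M', hM'⟩ := Nat.exists_eq_add_of_le hM3
    rw [hQ, hM'] at hGcard
    rw [hM', show 3 + M' - 3 = M' by omega] at hle
    have h2A : 2 * A < r := by nlinarith
    have hmw : 4 * (m * w) ≤ r := by
      refine le_trans ?_ hr
      calc 4 * (m * w) = 2 * (2 * (m * w)) := by ring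
        _ ≤ 2 * (m * (m * w)) := by gcongr
        _ = _ := by ring
    have : (3 + M') * r = 3 * r + r * M' := by ring
    omega

end Points

section FrobeniusFixed

variable {k Ω : Type*} [Field k] [Field Ω] [Algebra k Ω]

theorem exists_intermediateField_card_eq [Finite k] [IsAlgClosed Ω] {n : ℕ} (hn : 0 < n) :
    ∃ L : IntermediateField k Ω, Nat.card L = Nat.card k ^ n ∧
      ∀ z, z ∈ L ↔ z ^ Nat.card k ^ n = z := by
  classical
  have := Fintype.ofFinite k
  set q := Nat.card k with hqdef
  have hq : 2 ≤ q := Finite.one_lt_card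
  obtain ⟨p, hp⟩ := CharP.exists k
  have hpp : Fact p.Prime := ⟨CharP.char_is_prime k p⟩
  have : CharP Ω p := charP_of_injective_algebraMap (algebraMap k Ω).injective p
  have hpq : p ∣ q := by
    rw [hqdef, Nat.card_eq_fintype_card]
    exact (CharP.cast_eq_zero_iff k p _).1 (by simp)
  have hQ : 1 < q ^ n := Nat.one_lt_pow hn.ne' hq
  let φ : Ω →ₐ[k] Ω := FiniteField.frobeniusAlgHom k Ω ^ n
  have hφ : ∀ z, φ z = z ^ q ^ n := by
    intro z
    rw [hqdef, Nat.card_eq_fintype_card]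
    simp [φ, FiniteField.coe_frobeniusAlgHom, AlgHom.coe_pow, pow_iterate]
  let L : IntermediateField k Ω := (AlgHom.equalizer φ (AlgHom.id k Ω)).toIntermediateField
    (fun z hz => by
      rw [AlgHom.mem_equalizer] at hz ⊢
      rw [map_inv₀, map_inv₀, hz])
  have hL : ∀ z, z ∈ L ↔ z ^ q ^ n = z := by
    intro z
    rw [← hφ]
    exact AlgHom.mem_equalizer _ _ _
  refine ⟨L, ?_, hL⟩
  have hdeg : (X ^ q ^ n - X : Polynomial Ω).natDegree = q ^ n :=
    FiniteField.X_pow_card_sub_X_natDegree_eq Ω hQ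
  have hcard : (X ^ q ^ n - X : Polynomial Ω).roots.toFinset.card = q ^ n := by
    rw [Multiset.toFinset_card_of_nodup, ← (IsAlgClosed.splits _).natDegree_eq_card_roots, hdeg]
    exact nodup_roots (galois_poly_separable p _ (dvd_pow hpq hn.ne'))
  rw [← hcard, ← Fintype.card_coe, ← Nat.card_eq_fintype_card]
  refine Nat.card_congr (Equiv.subtypeEquivRight fun z => ?_)
  rw [hL, Multiset.mem_toFinset, mem_roots (FiniteField.X_pow_card_sub_X_ne_zero Ω hQ)]
  simp [sub_eq_zero]

end FrobeniusFixed

section Residue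

theorem card_resF_eq {k K L : Type*} [Field k] [Finite k] [Field K] [Algebra k K] [Field L]
    [Algebra k L] {n : ℕ} (hL : Nat.card L = Nat.card k ^ n) (O : ValuationSubring K)
    (ρ : O →+* L) [IsLocalHom ρ] (hk : ∀ c : k, ∃ a, ρ a = algebraMap k L c) (a : O)
    (ha : ∀ d, 1 ≤ d → d ≤ n / 2 → ρ a ^ Nat.card k ^ d ≠ ρ a) :
    Nat.card (ResF O) = Nat.card k ^ n := by
  have hq : 1 < Nat.card k := Finite.one_lt_card
  have : Finite L := Nat.finite_of_card_ne_zero (by rw [hL]; exact (pow_pos (by omega) _).ne')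
  let σ : ResF O →+* L := IsLocalRing.ResidueField.lift ρ
  let E : IntermediateField k L := σ.fieldRange.toIntermediateField (fun c => by
    obtain ⟨a, ha⟩ := hk c
    exact ⟨IsLocalRing.residue _ a, by rw [← ha]; rfl⟩)
  have hE : Nat.card (ResF O) = Nat.card E :=
    Nat.card_congr (σ.rangeRestrictFieldEquiv).toEquiv
  have h1 : Nat.card E = Nat.card k ^ finrank k E := natCard_eq_pow_finrank
  have h2 : finrank k L = n := by
    have : Nat.card L = Nat.card k ^ finrank k L := natCard_eq_pow_finrank
    exact Nat.pow_right_injective hq (this.symm.trans hL)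
  rw [hE, h1]
  congr 1
  have hdvd : finrank k E ∣ n := ⟨finrank E L, by rw [← h2, finrank_mul_finrank]⟩
  have hpos : 0 < finrank k E := finrank_pos
  obtain ⟨c, hc⟩ := hdvd
  rcases Nat.lt_or_ge c 2 with h | h
  · interval_cases c
    · have : 0 < finrank k L := finrank_pos
      omega
    · omega
  · exfalso
    refine ha (finrank k E) hpos (by
      rw [Nat.le_div_iff_mul_le two_pos, hc]
      exact Nat.mul_le_mul_left _ h) ?_
    rw [← h1]
    have := Fintype.ofFinite E
    have h3 := FiniteField.pow_card (⟨ρ a, ⟨IsLocalRing.residue _ a, rfl⟩⟩ : E)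
    rw [← Nat.card_eq_fintype_card] at h3
    exact congrArg Subtype.val h3

theorem exists_valuationSubring_of_powerSeries {K L : Type*} [Field K] [Field L]
    (ψ : K →+* FractionRing (PowerSeries L)) : ∃ (O : ValuationSubring K) (ρ : O →+* L),
      IsLocalHom ρ ∧ ∀ z b, algebraMap _ _ b = ψ z →
        ∃ h : z ∈ O, ρ ⟨z, h⟩ = PowerSeries.constantCoeff b := by
  let O : ValuationSubring K := ValuationSubring.comap
    (ValuationRing.valuation (PowerSeries L) (FractionRing (PowerSeries L))).valuationSubring ψ
  have hO : ∀ z, z ∈ O ↔ ∃ b : PowerSeries L, algebraMap _ _ b = ψ z := by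
    intro z
    rw [ValuationSubring.mem_comap]
    exact ValuationRing.mem_integer_iff _ _ _
  have hinj : Function.Injective (algebraMap (PowerSeries L) (FractionRing (PowerSeries L))) :=
    IsFractionRing.injective _ _
  choose b hb using fun z : O => (hO z).1 z.2
  have hbu : ∀ (z : O) c, algebraMap _ _ c = ψ z → b z = c := fun z c hc =>
    hinj ((hb z).trans hc.symm)
  let ρ : O →+* L := PowerSeries.constantCoeff.comp
    { toFun := b
      map_one' := hbu _ _ (by simp)
      map_zero' := hbu _ _ (by simp)
      map_mul' := fun z w => hbu _ _ (by simp [hb])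
      map_add' := fun z w => hbu _ _ (by simp [hb]) }
  refine ⟨O, ρ, ⟨fun z hz => ?_⟩, fun z c hc => ⟨(hO z).2 ⟨c, hc⟩, ?_⟩⟩
  · have hu : IsUnit (b z) := PowerSeries.isUnit_iff_constantCoeff.2 hz
    obtain ⟨u, hu⟩ := hu
    have hz0 : (z : K) ≠ 0 := by
      intro h
      have h1 : b z = 0 := hbu _ _ (by simp [h])
      exact u.ne_zero (hu.trans h1)
    have hinv : (z : K)⁻¹ ∈ O := by
      refine (hO _).2 ⟨((u⁻¹ : _ˣ) : PowerSeries L), ?_⟩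
      rw [map_inv₀, ← hb, ← hu]
      refine eq_inv_of_mul_eq_one_left ?_
      rw [← map_mul, Units.inv_mul, map_one]
    exact IsUnit.of_mul_eq_one ⟨_, hinv⟩ (Subtype.ext (mul_inv_cancel₀ hz0))
  · change PowerSeries.constantCoeff (b _) = _
    rw [hbu ⟨z, _⟩ c hc]

end Residue

section PlaceOfPoint

theorem dvd_of_aevalAeval_eq_zero {k A : Type*} [Field k] [CommRing A] [Algebra k A] {x y : A}
    (hx : Transcendental k x) {F : k[X][Y]} {e : ℕ} (hF : F.Monic) (hirr : Irreducible F)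
    (hw : WtBound F e F.natDegree) (h0 : aevalAeval x y F = 0) {P : k[X][Y]}
    (hP : aevalAeval x y P = 0) : F ∣ P := by
  by_contra hndvd
  obtain ⟨t, ht⟩ := exists_wt e P
  obtain ⟨N, V, hN, -, W, hW⟩ := exists_dvd_mul_sub_C hF hirr hw hndvd ht
  have := congrArg (aevalAeval x y) hW
  rw [map_sub, map_mul, map_mul, hP, h0, zero_mul, zero_mul, zero_sub, neg_eq_zero] at this
  refine hN ((transcendental_iff.1 hx) N ?_)
  rw [← this]
  simp

theorem transcendental_C_add_X {k L : Type*} [Field k] [Field L] [Algebra k L] (α : L) :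
    Transcendental k (PowerSeries.C α + PowerSeries.X : PowerSeries L) := by
  rw [transcendental_iff]
  intro N hN
  have h1 : aeval (PowerSeries.C α + PowerSeries.X : PowerSeries L) N =
      (((N.map (algebraMap k L)).comp (C α + X) : Polynomial L) : PowerSeries L) := by
    have : (PowerSeries.C α + PowerSeries.X : PowerSeries L) =
      (coeToPowerSeries.algHom L (R := L)) (C α + X) := by
      simp
    rw [this, ← aeval_map_algebraMap L, aeval_algHom_apply]
    simp [comp, aeval_def, eval₂_eq_eval_map]
  rw [h1, coe_eq_zero_iff, comp_eq_zero_iff] at hN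
  rcases hN with h | ⟨-, h⟩
  · exact (Polynomial.map_eq_zero _).1 h
  · have := congrArg (fun P => coeff P 1) h
    simp at this

theorem exists_powerSeries_root {k L : Type*} [Field k] [Field L] [Algebra k L] {F : k[X][Y]}
    (hF : F.Monic) {α β : L} (h0 : aevalAeval α β F = 0)
    (h1 : aevalAeval α β (derivative F) ≠ 0) : ∃ η : PowerSeries L,
      aevalAeval (PowerSeries.C α + PowerSeries.X : PowerSeries L) η F = 0 ∧
        PowerSeries.constantCoeff η = β := by
  have hens : HenselianRing (PowerSeries L) (.span {PowerSeries.X}) := inferInstance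
  set a : PowerSeries L := PowerSeries.C α + PowerSeries.X with ha
  let φ : k[X] →+* PowerSeries L := (aeval a : k[X] →ₐ[k] PowerSeries L).toRingHom
  have hcc : ∀ P : k[X][Y], PowerSeries.constantCoeff (aevalAeval a (PowerSeries.C β) P) =
      aevalAeval α β P := by
    intro P
    let f : PowerSeries L →ₐ[k] L :=
      { toRingHom := PowerSeries.constantCoeff
        commutes' := fun r => by simp [PowerSeries.algebraMap_apply] }
    have := aevalAeval_algHom_apply f a (PowerSeries.C β) P
    have e1 : f a = α := by simp [f, ha]
    have e2 : f (PowerSeries.C β) = β := by simp [f]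
    rw [e1, e2] at this
    exact this.symm
  obtain ⟨η, hη, hη0⟩ := hens.is_henselian (F.map φ) (hF.map _) (PowerSeries.C β) (by
    rw [Ideal.mem_span_singleton, PowerSeries.X_dvd_iff, ← aevalAeval_eq_eval_map, hcc, h0]) (by
    rw [derivative_map, ← aevalAeval_eq_eval_map]
    refine IsUnit.map _ (PowerSeries.isUnit_iff_constantCoeff.2 ?_)
    rw [hcc]
    exact h1.isUnit)
  refine ⟨η, ?_, ?_⟩
  · rw [aevalAeval_eq_eval_map]
    exact hη
  · rw [Ideal.mem_span_singleton, PowerSeries.X_dvd_iff, map_sub, sub_eq_zero] at hη0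
    simpa using hη0

theorem exists_place_of_point {k K Ω : Type*} [Field k] [Finite k] [Field K] [Algebra k K]
    [Field Ω] [Algebra k Ω] [IsAlgClosed Ω] {x y : K} {F : k[X][Y]} {e : ℕ}
    (hF : F.Monic) (hirr : Irreducible F)
    (hw : WtBound F e F.natDegree) (h0 : aevalAeval x y F = 0)
    (hx : Transcendental k x)
    (hfrac : ∀ z : K, ∃ P Q : k[X][Y], aevalAeval x y Q ≠ 0 ∧
      z = aevalAeval x y P / aevalAeval x y Q)
    {n : ℕ} (hn : 0 < n) {α β : Ω} (hα : α ^ Nat.card k ^ n = α)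
    (hα' : ∀ d, 1 ≤ d → d ≤ n / 2 → α ^ Nat.card k ^ d ≠ α) (hβ : β ^ Nat.card k ^ n = β)
    (hαβ : aevalAeval α β F = 0) (hαβ' : aevalAeval α β (derivative F) ≠ 0) :
    ∃ O : ValuationSubring K, IsPlace (algebraMap k K) O ∧
      Nat.card (ResF O) = Nat.card k ^ n := by
  obtain ⟨L, hL, hmem⟩ := exists_intermediateField_card_eq (k := k) (Ω := Ω) hn
  have hQ : 1 < Nat.card k ^ n := Nat.one_lt_pow hn.ne' Finite.one_lt_card
  have : Finite L := Nat.finite_of_card_ne_zero (by omega)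
  lift α to L using (hmem _).2 hα
  lift β to L using (hmem _).2 hβ
  have hval : ∀ P : k[X][Y], aevalAeval (α : Ω) (β : Ω) P = (aevalAeval α β P : L) :=
    fun P => aevalAeval_algHom_apply L.val α β P
  rw [hval] at hαβ hαβ'
  obtain ⟨η, hη, hηβ⟩ := exists_powerSeries_root hF (α := α) (β := β) (by simpa using hαβ)
    (by simpa using hαβ')
  set a : PowerSeries L := PowerSeries.C α + PowerSeries.X with ha
  have hker : ∀ P : k[X][Y], aevalAeval x y P = 0 ↔ aevalAeval a η P = 0 := by
    intro P
    constructor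
    · intro h
      obtain ⟨W, rfl⟩ := dvd_of_aevalAeval_eq_zero hx hF hirr hw h0 h
      rw [map_mul, hη, zero_mul]
    · intro h
      obtain ⟨W, rfl⟩ := dvd_of_aevalAeval_eq_zero (transcendental_C_add_X α) hF hirr hw hη h
      rw [map_mul, h0, zero_mul]
  let B : Subalgebra k K := (aevalAeval (R := k) x y).range
  let θ₀ : k[X][Y] →ₐ[k] B := (aevalAeval (R := k) x y).rangeRestrict
  have hθ₀ : Function.Surjective θ₀ := (aevalAeval (R := k) x y).rangeRestrict_surjective
  obtain ⟨θ₁, hθ₁⟩ : ∃ θ₁ : B →+* PowerSeries L, ∀ P : k[X][Y],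
      θ₁ (θ₀ P) = aevalAeval a η P := by
    have hle : RingHom.ker θ₀.toRingHom ≤ RingHom.ker (aevalAeval (R := k) a η).toRingHom := by
      intro P hP
      have h : θ₀ P = 0 := hP
      exact (hker P).1 (congrArg Subtype.val h)
    exact ⟨θ₀.toRingHom.liftOfSurjective hθ₀ ⟨_, hle⟩, fun P =>
      RingHom.liftOfSurjective_comp_apply θ₀.toRingHom hθ₀ ⟨_, hle⟩ P⟩
  let θ : B →+* FractionRing (PowerSeries L) := (algebraMap _ _).comp θ₁
  have hθ : ∀ P : k[X][Y], θ (θ₀ P) = algebraMap _ _ (aevalAeval a η P) := by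
    intro P
    rw [← hθ₁]
    rfl
  have hinj : Function.Injective (algebraMap (PowerSeries L) (FractionRing (PowerSeries L))) :=
    IsFractionRing.injective _ _
  have hθinj : Function.Injective θ := by
    rw [injective_iff_map_eq_zero]
    intro b hb
    obtain ⟨P, rfl⟩ := hθ₀ b
    rw [hθ, map_eq_zero_iff _ hinj, ← hker] at hb
    exact Subtype.ext hb
  have : IsFractionRing B K := IsFractionRing.of_field _ _ fun z => by
    obtain ⟨P, Q, -, h⟩ := hfrac z
    exact ⟨θ₀ P, θ₀ Q, h⟩
  let ψ : K →+* FractionRing (PowerSeries L) := IsFractionRing.lift hθinj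
  have hψ : ∀ P : k[X][Y], ψ (aevalAeval x y P) = algebraMap _ _ (aevalAeval a η P) := by
    intro P
    rw [← hθ]
    exact IsFractionRing.lift_algebraMap hθinj (θ₀ P)
  obtain ⟨O, ρ, hρ, hOρ⟩ := exists_valuationSubring_of_powerSeries ψ
  have hcc : ∀ P : k[X][Y], PowerSeries.constantCoeff (aevalAeval a η P) = aevalAeval α β P := by
    intro P
    let f : PowerSeries L →ₐ[k] L :=
      { toRingHom := PowerSeries.constantCoeff
        commutes' := fun r => by simp [PowerSeries.algebraMap_apply] }
    have := aevalAeval_algHom_apply f a η P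
    have e1 : f a = α := by simp [f, ha]
    have e2 : f η = β := hηβ
    rw [e1, e2] at this
    exact this.symm
  have hOP : ∀ P : k[X][Y], ∃ h : aevalAeval x y P ∈ O, ρ ⟨_, h⟩ = aevalAeval α β P := by
    intro P
    rw [← hcc]
    exact hOρ _ _ (hψ P).symm
  have hk : ∀ c : k, ∃ h : algebraMap k K c ∈ O, ρ ⟨_, h⟩ = algebraMap k L c := by
    intro c
    have := hOP (C (C c))
    simpa [aevalAeval_eq_eval_map] using this
  refine ⟨O, ⟨?_, fun c => (hk c).1⟩, ?_⟩
  · rintro rfl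
    obtain ⟨h, hz⟩ := hOP (C (X ^ Nat.card k ^ n - X : k[X]) : k[X][Y])
    have hz' : aevalAeval α β (C (X ^ Nat.card k ^ n - X : k[X]) : k[X][Y]) = 0 := by
      simp [sub_eq_zero, Subtype.ext_iff, hα]
    rw [hz'] at hz
    have hne : aevalAeval x y (C (X ^ Nat.card k ^ n - X : k[X]) : k[X][Y]) ≠ 0 := by
      have := (transcendental_iff.1 hx) (X ^ Nat.card k ^ n - X)
      simp only [aevalAeval_eq_eval_map, Polynomial.map_C, eval_C]
      exact fun h => FiniteField.X_pow_card_sub_X_ne_zero k hQ (this h)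
    have hu : IsUnit (⟨_, h⟩ : (⊤ : ValuationSubring K)) := by
      refine IsUnit.of_mul_eq_one ⟨_, ValuationSubring.mem_top (aevalAeval x y _)⁻¹⟩
        (Subtype.ext (mul_inv_cancel₀ hne))
    exact not_isUnit_zero (hz ▸ hu.map ρ)
  · obtain ⟨h, hz⟩ := hOP (C X)
    have hz' : aevalAeval α β (C X : k[X][Y]) = α := by simp
    refine card_resF_eq hL O ρ (fun c => ⟨⟨_, (hk c).1⟩, (hk c).2⟩) ⟨_, h⟩ fun d h1 h2 h3 => ?_
    rw [hz, hz'] at h3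
    exact hα' d h1 h2 (by simpa using congrArg Subtype.val h3)

end PlaceOfPoint

section FunctionField

open scoped IntermediateField.algebraAdjoinAdjoin
open IntermediateField

variable {k K : Type} [Field k] [Field K] [Algebra k K]

theorem isTranscendenceBasis_of_isFunctionField (hK : IsFunctionField k K) {s : K}
    (hs : Transcendental k s) : IsTranscendenceBasis k (fun _ : Unit => s) := by
  obtain ⟨t, ht, hfin⟩ := hK.exists_primitive
  have ht' : IsTranscendenceBasis k (fun _ : Unit => t) := by
    rw [isTranscendenceBasis_iff_algebraicIndependent_isAlgebraic]
    refine ⟨(algebraicIndependent_unique_type_iff).2 ht, ?_⟩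
    rw [Set.range_const]
    exact Algebra.IsAlgebraic.trans _ k⟮t⟯ _
  refine ((algebraicIndependent_unique_type_iff).2 hs).isTranscendenceBasis_of_trdeg_le_of_finite ?_
  rw [← ht'.cardinalMk_eq_trdeg]

theorem essFiniteType_of_isFunctionField (hK : IsFunctionField k K) :
    Algebra.EssFiniteType k K := by
  obtain ⟨t, ht, hfin⟩ := hK.exists_primitive
  have : Algebra.EssFiniteType k k⟮t⟯ := by
    rw [IntermediateField.essFiniteType_iff]
    exact ⟨{t}, by simp⟩
  exact Algebra.EssFiniteType.comp k k⟮t⟯ K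

theorem finiteDimensional_adjoin_of_transcendental (hK : IsFunctionField k K) {s : K}
    (hs : Transcendental k s) : FiniteDimensional k⟮s⟯ K := by
  have h1 := (isTranscendenceBasis_of_isFunctionField hK hs).isAlgebraic_field
  rw [Set.range_const] at h1
  have := essFiniteType_of_isFunctionField hK
  have : Algebra.EssFiniteType k⟮s⟯ K := Algebra.EssFiniteType.of_comp k _ _
  exact Algebra.finite_of_essFiniteType_of_isAlgebraic

theorem exists_separating [Finite k] (hK : IsFunctionField k K) :
    ∃ t : K, Transcendental k t ∧ Algebra.IsSeparable k⟮t⟯ K := by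
  have := essFiniteType_of_isFunctionField hK
  obtain ⟨s, hs, hsep⟩ := exists_isTranscendenceBasis_and_isSeparable_of_perfectField (k := k) (K := K)
  obtain ⟨t, ht, -⟩ := hK.exists_primitive
  have h1 := (isTranscendenceBasis_of_isFunctionField hK ht).cardinalMk_eq_trdeg
  rw [← hs.cardinalMk_eq_trdeg] at h1
  have h2 : s.card = 1 := by
    simpa using h1.symm
  obtain ⟨u, rfl⟩ := Finset.card_eq_one.1 h2
  rw [Finset.coe_singleton] at hsep
  refine ⟨u, ?_, hsep⟩
  exact hs.1.transcendental ⟨u, by simp⟩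

end FunctionField

section ResidueField

open scoped IntermediateField.algebraAdjoinAdjoin
open IntermediateField

variable {k K : Type} [Field k] [Field K] [Algebra k K]

theorem X_pow_dvd_of_sum_eq_zero {ι : Type*} (S : Finset ι) {O : ValuationSubring K}
    (hk : ∀ c, algebraMap k K c ∈ O) {s : K} (hs0 : s ≠ 0) (hs : s ∈ O)
    (hsm : IsLocalRing.residue O ⟨s, hs⟩ = 0) (u : ι → O)
    (hu : ∀ c : ι → k, ∑ i ∈ S, IsLocalRing.residue O (⟨algebraMap k K (c i), hk _⟩ * u i) = 0 →
      ∀ i ∈ S, c i = 0) (d : ℕ) :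
    ∀ P : ι → k[X], ∑ i ∈ S, aeval s (P i) * (u i : K) = 0 → ∀ i ∈ S, X ^ d ∣ P i := by
  induction d with
  | zero => simp
  | succ d ih =>
    intro P hP
    have hmem : ∀ p : k[X], aeval s p ∈ O := by
      intro p
      rw [aeval_eq_sum_range]
      refine sum_mem fun i _ => ?_
      rw [Algebra.smul_def]
      exact mul_mem (hk _) (pow_mem hs _)
    have hdiv : ∀ p : k[X], aeval s p = algebraMap k K (p.coeff 0) + s * aeval s (divX p) := by
      intro p
      conv_lhs => rw [← X_mul_divX_add p]
      rw [map_add, map_mul, aeval_X, aeval_C, add_comm]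
    have h0 : ∀ i ∈ S, (P i).coeff 0 = 0 := by
      refine hu _ ?_
      have h1 : ∑ i ∈ S, (⟨algebraMap k K ((P i).coeff 0), hk _⟩ * u i : O) =
          - (⟨s, hs⟩ * ∑ i ∈ S, ⟨_, hmem (divX (P i))⟩ * u i) := by
        apply Subtype.ext
        push_cast
        rw [eq_neg_iff_add_eq_zero, ← hP, Finset.mul_sum, ← Finset.sum_add_distrib]
        refine Finset.sum_congr rfl fun i _ => ?_
        rw [hdiv (P i)]
        ring
      rw [← map_sum, h1, map_neg, map_mul, hsm, zero_mul, neg_zero]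
    have h2 : ∑ i ∈ S, aeval s (divX (P i)) * (u i : K) = 0 := by
      refine (mul_eq_zero_iff_left hs0).1 (Eq.trans ?_ hP)
      rw [Finset.mul_sum]
      refine Finset.sum_congr rfl fun i hi => ?_
      rw [hdiv (P i), h0 i hi]
      simp
      ring
    intro i hi
    obtain ⟨Q, hQ⟩ := ih _ h2 i hi
    refine ⟨Q, ?_⟩
    rw [← X_mul_divX_add (P i), h0 i hi, hQ, pow_succ]
    simp
    ring

theorem card_resF_of_isPlace [Finite k] (hK : IsFunctionField k K) {O : ValuationSubring K}
    (hO : IsPlace (algebraMap k K) O) : ∃ m, 1 ≤ m ∧ Nat.card (ResF O) = Nat.card k ^ m := by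
  obtain ⟨htop, hk⟩ := hO
  obtain ⟨z, hz⟩ : ∃ z, z ∉ O := by
    by_contra! h
    exact htop (top_le_iff.1 fun x _ => h x)
  have hz0 : z ≠ 0 := by
    rintro rfl
    exact hz (zero_mem _)
  have hs : z⁻¹ ∈ O := (O.mem_or_inv_mem z).resolve_left hz
  have hsm : IsLocalRing.residue O ⟨z⁻¹, hs⟩ = 0 := by
    rw [IsLocalRing.residue_eq_zero_iff, IsLocalRing.mem_maximalIdeal]
    intro hu
    obtain ⟨w, hw⟩ := hu.exists_right_inv
    have : (z⁻¹ : K) * w = 1 := congrArg Subtype.val hw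
    have h2 : z = w := by
      field_simp at this
      exact this.symm
    exact hz (h2 ▸ w.2)
  have htr : Transcendental k z⁻¹ := by
    intro h
    obtain ⟨c, hc⟩ := hK.constants_closed _ h
    refine hz ?_
    rw [← inv_inv z, ← hc, ← map_inv₀]
    exact hk _
  have hfin := finiteDimensional_adjoin_of_transcendental hK htr
  let ι : k →+* O := (algebraMap k K).codRestrict O hk
  let _ : Algebra k (ResF O) := ((IsLocalRing.residue O).comp ι).toAlgebra
  have hrank : Module.rank k (ResF O) ≤ (finrank k⟮z⁻¹⟯ K : ℕ) := by
    refine rank_le fun S hS => ?_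
    choose u hu using fun x : S => IsLocalRing.residue_surjective x.1
    have hind : LinearIndependent (Algebra.adjoin k {z⁻¹}) (fun i => (u i : K)) := by
      rw [Fintype.linearIndependent_iff]
      intro g hg i
      have hg' : ∀ i, ∃ P : k[X], aeval z⁻¹ P = (g i : K) := by
        intro i
        have h := Algebra.adjoin_singleton_eq_range_aeval k z⁻¹
        exact h.le (g i).2
      choose P hP using hg'
      have h1 := X_pow_dvd_of_sum_eq_zero Finset.univ hk (inv_ne_zero hz0) hs hsm u (by
        intro c hc i _
        refine (Fintype.linearIndependent_iff.1 hS) c (Eq.trans ?_ hc) i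
        refine Finset.sum_congr rfl fun i _ => ?_
        rw [map_mul, hu, Algebra.smul_def]
        rfl) ((P i).natDegree + 1) P (by
        rw [← hg]
        refine Finset.sum_congr rfl fun i _ => ?_
        rw [hP]
        rfl) i (Finset.mem_univ _)
      have h2 : P i = 0 := by
        by_contra h
        have := natDegree_le_of_dvd h1 h
        simp at this
      have h3 := hP i
      rw [h2, map_zero] at h3
      exact Subtype.ext h3.symm
    have := ((LinearIndependent.iff_fractionRing (Algebra.adjoin k {z⁻¹}) k⟮z⁻¹⟯).1
      hind).fintype_card_le_finrank
    simpa using this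
  have : Module.Finite k (ResF O) := by
    rw [← Module.rank_lt_aleph0_iff]
    exact hrank.trans_lt (Cardinal.natCast_lt_aleph0)
  exact ⟨finrank k (ResF O), finrank_pos, natCard_eq_pow_finrank⟩

end ResidueField

section Finiteness

open scoped IntermediateField.algebraAdjoinAdjoin
open IntermediateField

variable {k K : Type} [Field k] [Field K] [Algebra k K]

theorem isDedekindDomain_integralClosure_adjoin {t : K} [FiniteDimensional k⟮t⟯ K]
    [Algebra.IsSeparable k⟮t⟯ K] : IsDedekindDomain (integralClosure (Algebra.adjoin k {t}) K) := by
  have : IsPrincipalIdealRing (Algebra.adjoin k {t}) := by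
    let t' : Algebra.adjoin k {t} := ⟨t, Algebra.self_mem_adjoin_singleton k t⟩
    refine IsPrincipalIdealRing.of_surjective (aeval t' : k[X] →ₐ[k] _).toRingHom fun a => ?_
    obtain ⟨P, hP⟩ := (Algebra.adjoin_singleton_eq_range_aeval k t).le a.2
    refine ⟨P, Subtype.ext (Eq.trans ?_ hP)⟩
    exact (aeval_algHom_apply (Algebra.adjoin k {t}).val t' P).symm
  exact integralClosure.isDedekindDomain (Algebra.adjoin k {t}) k⟮t⟯ K

theorem mem_iff_of_dedekind {B : Type*} [CommRing B] [IsDedekindDomain B] [Algebra B K]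
    [IsFractionRing B K] (v : IsDedekindDomain.HeightOneSpectrum B) {O : ValuationSubring K}
    (hB : ∀ b, algebraMap B K b ∈ O)
    (hv : ∀ b, b ∈ v.asIdeal ↔ (⟨_, hB b⟩ : O) ∈ IsLocalRing.maximalIdeal O) {z : K} :
    z ∈ O ↔ ∃ a b, b ∉ v.asIdeal ∧ z * algebraMap B K b = algebraMap B K a := by
  have hun : ∀ b, b ∉ v.asIdeal → algebraMap B K b ≠ 0 ∧ (algebraMap B K b)⁻¹ ∈ O := by
    intro b hb
    rw [hv, IsLocalRing.mem_maximalIdeal, mem_nonunits_iff, not_not] at hb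
    obtain ⟨w, hw⟩ := hb.exists_right_inv
    have h1 : algebraMap B K b * w = 1 := congrArg Subtype.val hw
    have h0 : algebraMap B K b ≠ 0 := left_ne_zero_of_mul_eq_one h1
    refine ⟨h0, ?_⟩
    rw [← eq_inv_of_mul_eq_one_right h1]
    exact w.2
  constructor
  · intro hz
    obtain ⟨n, ⟨d, hd⟩, h | h⟩ := v.exists_primeCompl_mul_eq_or_mul_eq z
    · exact ⟨n, d, hd, h⟩
    · refine ⟨d, n, ?_, h⟩
      intro hn
      refine hd ((hv d).2 ?_)
      have : (⟨_, hB d⟩ : O) = ⟨z, hz⟩ * ⟨_, hB n⟩ := Subtype.ext h.symm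
      rw [this]
      exact Ideal.mul_mem_left _ _ ((hv n).1 hn)
  · rintro ⟨a, b, hb, h⟩
    obtain ⟨h0, hinv⟩ := hun b hb
    have : z = algebraMap B K a * (algebraMap B K b)⁻¹ := by
      rw [← h, mul_inv_cancel_right₀ h0]
    rw [this]
    exact mul_mem (hB a) hinv

theorem finite_places_of_mem [Finite k] {t : K} (ht : Transcendental k t)
    [FiniteDimensional k⟮t⟯ K] [Algebra.IsSeparable k⟮t⟯ K] {n : ℕ} (hn : 1 < n) :
    {O : ValuationSubring K | IsPlace (algebraMap k K) O ∧ t ∈ O ∧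
      Nat.card (ResF O) = n}.Finite := by
  have hded := isDedekindDomain_integralClosure_adjoin (k := k) (t := t)
  let A := Algebra.adjoin k {t}
  let B := integralClosure A K
  have hfr : IsFractionRing B K := integralClosure.isFractionRing_of_finite_extension k⟮t⟯ K
  let t' : A := ⟨t, Algebra.self_mem_adjoin_singleton k t⟩
  let b : B := algebraMap A B (t' ^ n - t')
  have hb : b ≠ 0 := by
    intro h
    have h1 : t ^ n - t = 0 := congrArg (Subtype.val) h
    refine FiniteField.X_pow_card_sub_X_ne_zero k hn ((transcendental_iff.1 ht) _ ?_)
    simpa using h1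
  have hfin := Ideal.finite_factors (I := Ideal.span {b}) (by simpa using hb)
  have key : ∀ O : ValuationSubring K, IsPlace (algebraMap k K) O → t ∈ O →
      Nat.card (ResF O) = n → ∃ v : IsDedekindDomain.HeightOneSpectrum B, 
      v.asIdeal ∣ Ideal.span {b} ∧ ∀ z, z ∈ O ↔
        ∃ a b, b ∉ v.asIdeal ∧ z * algebraMap B K b = algebraMap B K a := by
    intro O hO htO hcard
    have hA : ∀ a : A, (a : K) ∈ O := by
      intro a
      have h : A ≤ { O with algebraMap_mem' := hO.2 } := by
        rw [Algebra.adjoin_le_iff]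
        simpa using htO
      exact h a.2
    have hB : ∀ b : B, algebraMap B K b ∈ O := by
      intro b
      have h1 : IsIntegral A (b : K) := b.2
      let f : A →+* O := A.val.toRingHom.codRestrict O hA
      have h2 : IsIntegral O (b : K) := by
        obtain ⟨p, hp, h⟩ := h1
        refine ⟨p.map f, hp.map _, ?_⟩
        rw [eval₂_map]
        exact h
      obtain ⟨c, hc⟩ := IsIntegrallyClosed.isIntegral_iff.1 h2
      exact (show algebraMap B K b = c from hc.symm) ▸ c.2
    let g : B →+* O := (algebraMap B K).codRestrict O hB
    have hbP : g b ∈ IsLocalRing.maximalIdeal O := by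
      rw [← IsLocalRing.residue_eq_zero_iff]
      have : Finite (ResF O) := Nat.finite_of_card_ne_zero (by omega)
      have := Fintype.ofFinite (ResF O)
      have h := FiniteField.pow_card (IsLocalRing.residue O ⟨t, htO⟩)
      rw [← Nat.card_eq_fintype_card, hcard, ← map_pow, ← sub_eq_zero, ← map_sub] at h
      exact h
    have hb' : b ∈ (IsLocalRing.maximalIdeal O).comap g := hbP
    let v : IsDedekindDomain.HeightOneSpectrum B :=
      ⟨(IsLocalRing.maximalIdeal O).comap g, inferInstance, fun h => hb (by rwa [h] at hb')⟩
    refine ⟨v, ?_, fun z => mem_iff_of_dedekind v hB fun b => Iff.rfl⟩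
    rw [Ideal.dvd_span_singleton]
    exact hb'
  choose V hV1 hV2 using fun O : {O : ValuationSubring K | IsPlace (algebraMap k K) O ∧ t ∈ O ∧
    Nat.card (ResF O) = n} => key O O.2.1 O.2.2.1 O.2.2.2
  have : Finite {v : IsDedekindDomain.HeightOneSpectrum B | v.asIdeal ∣ Ideal.span {b}} := hfin
  refine Finite.of_injective (fun O => (⟨V O, hV1 O⟩ :
    {v : IsDedekindDomain.HeightOneSpectrum B | v.asIdeal ∣ Ideal.span {b}})) fun O O' h => ?_
  ext z
  have h' : V O = V O' := congrArg Subtype.val h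
  rw [hV2 O, hV2 O', h']

theorem finite_places [Finite k] (hK : IsFunctionField k K) {n : ℕ} (hn : 1 < n) :
    {O : ValuationSubring K | IsPlace (algebraMap k K) O ∧ Nat.card (ResF O) = n}.Finite := by
  obtain ⟨t, ht, hsep⟩ := exists_separating hK
  have hfin := finiteDimensional_adjoin_of_transcendental hK ht
  have h1 := finite_places_of_mem ht hn
  have ht' : Transcendental k t⁻¹ := fun h => ht (by simpa using h.inv)
  have heq : k⟮t⁻¹⟯ = k⟮t⟯ := by
    refine le_antisymm ?_ ?_ 
    · exact adjoin_simple_le_iff.2 (inv_mem (mem_adjoin_simple_self k t))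
    · exact adjoin_simple_le_iff.2 (by simpa using inv_mem (mem_adjoin_simple_self k t⁻¹))
  have hsep' : Algebra.IsSeparable k⟮t⁻¹⟯ K := heq ▸ hsep
  have hfin' := finiteDimensional_adjoin_of_transcendental hK ht'
  have h2 := finite_places_of_mem ht' hn
  refine (h1.union h2).subset fun O ⟨hO, hc⟩ => ?_
  exact (O.mem_or_inv_mem t).imp (fun h => ⟨hO, h, hc⟩) fun h => ⟨hO, h, hc⟩

end Finiteness

section Core

open IntermediateField

theorem pow_ne_of_isSeparable {k K : Type*} [Field k] [Field K] [Algebra k K] {p : ℕ}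
    [hp : Fact p.Prime] [CharP k p] {x : K} (hx : Transcendental k x) [Algebra.IsSeparable k⟮x⟯ K]
    (z : K) : z ^ p ≠ x := by
  intro hz
  have : CharP k⟮x⟯ p := charP_of_injective_algebraMap (algebraMap k _).injective p
  have h1 := adjoin_simple_eq_adjoin_pow_expChar_of_isSeparable' k⟮x⟯ K z p
  have h2 : z ∈ k⟮x⟯⟮z⟯ := mem_adjoin_simple_self _ _
  rw [h1, hz, mem_adjoin_simple_iff] at h2
  have h3 : z ∈ k⟮x⟯ := by
    obtain ⟨r, s, h⟩ := h2
    have hmem : ∀ r : Polynomial k⟮x⟯, aeval x r ∈ k⟮x⟯ := fun r => by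
      have h := aeval_algebraMap_apply K (⟨x, mem_adjoin_simple_self k x⟩ : k⟮x⟯) r
      exact h ▸ Subtype.prop _
    rw [h]
    exact div_mem (hmem r) (hmem s)
  obtain ⟨a, b, hab⟩ := (mem_adjoin_simple_iff k z).1 h3
  have hx0 : x ≠ 0 := fun h => hx (h ▸ isAlgebraic_zero)
  have hb : aeval x b ≠ 0 := by
    intro h
    rw [h, div_zero] at hab
    rw [hab, zero_pow hp.out.ne_zero] at hz
    exact hx0 hz.symm
  have hb0 : b ≠ 0 := by rintro rfl; simp at hb
  have h4 : a ^ p = X * b ^ p := by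
    refine sub_eq_zero.1 ((transcendental_iff.1 hx) _ ?_)
    rw [hab, div_pow, div_eq_iff (pow_ne_zero _ hb)] at hz
    simp [hz]
  have h5 := congrArg natDegree h4
  rw [natDegree_pow, natDegree_X_mul (pow_ne_zero _ hb0), natDegree_pow] at h5
  have h6 : p ∣ 1 := (Nat.dvd_add_right (Dvd.intro b.natDegree rfl)).1 (h5 ▸ Dvd.intro _ rfl)
  exact hp.out.one_lt.ne' (Nat.dvd_one.1 h6)

theorem isSeparable_adjoin_of_root {k K : Type*} [Field k] [Field K] [Algebra k K]
    {x y : K} {F : k[X][Y]} {e : ℕ} (hF : F.Monic) (hirr : Irreducible F)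
    (hw : WtBound F e F.natDegree) (h0 : aevalAeval x y F = 0)
    (hsep : derivative F ≠ 0) (hx : Transcendental k x)
    (hfrac : ∀ z : K, ∃ P Q : k[X][Y], aevalAeval x y Q ≠ 0 ∧
      z = aevalAeval x y P / aevalAeval x y Q) : Algebra.IsSeparable k⟮x⟯ K := by
  obtain ⟨N, hN, -, V, W, hW⟩ := exists_discriminant hF hirr hw hsep
  let x' : k⟮x⟯ := ⟨x, mem_adjoin_simple_self k x⟩
  let φ : k[X] →+* k⟮x⟯ := (aeval x' : k[X] →ₐ[k] k⟮x⟯).toRingHom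
  have hmap : ∀ P : k[X][Y], aeval y (P.map φ) = aevalAeval x y P := by
    intro P
    rw [aevalAeval_eq_eval_map, aeval_def, eval₂_eq_eval_map, Polynomial.map_map]
    congr 2
    refine Polynomial.ringHom_ext (fun a => ?_) ?_
    · simp [φ]
    · simp [φ, x']
  have hNx : φ N ≠ 0 := by
    intro h
    refine hN ((transcendental_iff.1 hx) N ?_)
    have := hmap (C N)
    rw [map_C, h] at this
    simpa using this.symm
  have hg : (F.map φ).Separable := by
    refine ⟨C (φ N)⁻¹ * -(W.map φ), C (φ N)⁻¹ * V.map φ, ?_⟩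
    have h1 := congrArg (Polynomial.map φ) hW
    simp only [Polynomial.map_sub, Polynomial.map_mul, map_C] at h1
    rw [derivative_map]
    have h2 : C (φ N)⁻¹ * C (φ N) = 1 := by rw [← C_mul, inv_mul_cancel₀ hNx, C_1]
    linear_combination C (φ N)⁻¹ * h1 + h2
  have hy : IsSeparable k⟮x⟯ y := hg.of_dvd (minpoly.dvd _ _ (by rw [hmap, h0]))
  have htop : k⟮x⟯⟮y⟯ = ⊤ := by
    rw [eq_top_iff]
    intro z _
    obtain ⟨P, Q, -, rfl⟩ := hfrac z
    rw [mem_adjoin_simple_iff]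
    exact ⟨P.map φ, Q.map φ, by rw [hmap, hmap]⟩
  rw [← isSeparable_adjoin_simple_iff_isSeparable, htop] at hy
  exact (AlgEquiv.Algebra.isSeparable_iff topEquiv).1 hy

theorem exists_place_card_eq {k K : Type} [Field k] [Field K] [Algebra k K] [Finite k]
    (hk : ∀ x : K, IsAlgebraic k x → ∃ c : k, algebraMap k K c = x) {x y : K}
    {F : k[X][Y]} {e : ℕ} (he : 1 ≤ e) (hF : F.Monic) (hirr : Irreducible F)
    (hw : WtBound F e F.natDegree) (h0 : aevalAeval x y F = 0)
    (hsep : derivative F ≠ 0) (hx : Transcendental k x)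
    (hfrac : ∀ z : K, ∃ P Q : k[X][Y], aevalAeval x y Q ≠ 0 ∧
      z = aevalAeval x y P / aevalAeval x y Q) {n : ℕ} (hn : 0 < n)
    (hnum : (F.natDegree = 1 ∧ 3 ≤ Nat.card k ^ (n - n / 2)) ∨ (2 ≤ F.natDegree ∧
      2 * F.natDegree * (2 + e * (F.natDegree - 1)) ≤ Nat.card k ^ (n / 2) ∧
      2 * F.natDegree ^ 2 * (e * (F.natDegree - 1)) ≤ Nat.card k ^ (n - n / 2))) :
    ∃ O : ValuationSubring K, IsPlace (algebraMap k K) O ∧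
      Nat.card (ResF O) = Nat.card k ^ n := by
  obtain ⟨p, hp⟩ := CharP.exists k
  have : Fact p.Prime := ⟨CharP.char_is_prime k p⟩
  have := isSeparable_adjoin_of_root hF hirr hw h0 hsep hx hfrac
  obtain ⟨α, β, h1, h2, h3, h4, h5⟩ := exists_point (Ω := AlgebraicClosure k) hk he hF hirr hw h0
    (fun P => dvd_of_aevalAeval_eq_zero hx hF hirr hw h0) (pow_ne_of_isSeparable (p := p) hx)
    hsep hn hnum
  exact exists_place_of_point hF hirr hw h0 hx hfrac hn h1 h2 h3 h4 h5

end Core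

section Cofinite

open IntermediateField

variable {k K : Type} [Field k] [Field K] [Algebra k K]

theorem exists_plane_model [Finite k] (hK : IsFunctionField k K) :
    ∃ (x y : K) (F : k[X][Y]), Transcendental k x ∧ F.Monic ∧ Irreducible F ∧
      derivative F ≠ 0 ∧ aevalAeval x y F = 0 ∧
      ∀ z : K, ∃ P Q : k[X][Y], aevalAeval x y Q ≠ 0 ∧
        z = aevalAeval x y P / aevalAeval x y Q := by
  obtain ⟨t, ht, hsep⟩ := exists_separating hK
  have hfin := finiteDimensional_adjoin_of_transcendental hK ht
  let t' : k⟮t⟯ := ⟨t, mem_adjoin_simple_self k t⟩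
  let _ : Algebra k[X] K := (aeval t : k[X] →ₐ[k] K).toRingHom.toAlgebra
  let _ : Algebra k[X] k⟮t⟯ := (aeval t' : k[X] →ₐ[k] k⟮t⟯).toRingHom.toAlgebra
  have hmapK : ∀ a : k[X], algebraMap k[X] K a = aeval t a := fun _ => rfl
  have hmapT : ∀ a : k[X], algebraMap k[X] k⟮t⟯ a = aeval t' a := fun _ => rfl
  have hcoe : ∀ a : k[X], algebraMap k⟮t⟯ K (aeval t' a) = aeval t a := fun a =>
    (aeval_algebraMap_apply K t' a).symm
  have : IsScalarTower k[X] k⟮t⟯ K := IsScalarTower.of_algebraMap_eq fun a => (hcoe a).symm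
  have hinj : Function.Injective (algebraMap k[X] K) := transcendental_iff_injective.1 ht
  have : FaithfulSMul k[X] K := (faithfulSMul_iff_algebraMap_injective _ _).2 hinj
  have hinjT : Function.Injective (algebraMap k[X] k⟮t⟯) := by
    rw [IsScalarTower.algebraMap_eq k[X] k⟮t⟯ K, RingHom.coe_comp] at hinj
    exact hinj.of_comp
  have : FaithfulSMul k[X] k⟮t⟯ := (faithfulSMul_iff_algebraMap_injective _ _).2 hinjT
  have : IsFractionRing k[X] k⟮t⟯ := by
    refine IsFractionRing.of_field k[X] k⟮t⟯ fun z => ?_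
    obtain ⟨r, s, h⟩ := (mem_adjoin_simple_iff k (z : K)).1 z.2
    refine ⟨r, s, Subtype.ext ?_⟩
    rw [h, hmapT, hmapT, ← hcoe, ← hcoe]
    rfl
  obtain ⟨y₀, hy₀⟩ := Field.exists_primitive_element k⟮t⟯ K
  obtain ⟨a, ha, hay⟩ := ((IsFractionRing.isAlgebraic_iff k[X] k⟮t⟯ K).2
    (Algebra.IsAlgebraic.isAlgebraic (R := k⟮t⟯) y₀)).exists_integral_multiple
  have hev : ∀ P : k[X][Y], aevalAeval t (a • y₀) P = aeval (a • y₀) P := fun P => by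
    rw [aevalAeval_eq_eval_map, aeval_def, eval₂_eq_eval_map]
    rfl
  have hmin := minpoly.isIntegrallyClosed_eq_field_fractions' k⟮t⟯ hay
  refine ⟨t, a • y₀, minpoly k[X] (a • y₀), ht, minpoly.monic hay, minpoly.irreducible hay,
    fun h => ?_, by rw [hev, minpoly.aeval], fun z => ?_⟩
  · have h1 := Algebra.IsSeparable.isSeparable k⟮t⟯ (a • y₀)
    rw [IsSeparable, hmin] at h1
    rw [separable_def, derivative_map, h, Polynomial.map_zero, isCoprime_zero_right,
      ← hmin] at h1
    exact minpoly.not_isUnit _ _ h1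
  · have htop : k⟮t⟯⟮a • y₀⟯ = ⊤ := by
      rw [eq_top_iff, ← hy₀, adjoin_simple_le_iff]
      have h1 : y₀ = algebraMap k⟮t⟯ K (algebraMap k[X] k⟮t⟯ a)⁻¹ * (a • y₀) := by
        rw [Algebra.smul_def, IsScalarTower.algebraMap_apply k[X] k⟮t⟯ K, map_inv₀,
          inv_mul_cancel_left₀]
        rwa [← IsScalarTower.algebraMap_apply, Ne, FaithfulSMul.algebraMap_eq_zero_iff]
      have h2 := mul_mem (IntermediateField.algebraMap_mem k⟮t⟯⟮a • y₀⟯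
        (algebraMap k[X] k⟮t⟯ a)⁻¹) (mem_adjoin_simple_self k⟮t⟯ (a • y₀))
      rwa [← h1] at h2
    have hclear : ∀ p : Polynomial k⟮t⟯, ∃ c : k[X], algebraMap k[X] K c ≠ 0 ∧ ∃ P : k[X][Y],
        aevalAeval t (a • y₀) P = algebraMap k[X] K c * aeval (a • y₀) p := by
      intro p
      obtain ⟨c, hc, hcp⟩ := IsLocalization.integerNormalization_spec (nonZeroDivisors k[X]) p
      refine ⟨c, by simpa using nonZeroDivisors.ne_zero hc,
        IsLocalization.integerNormalization (nonZeroDivisors k[X]) p, ?_⟩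
      rw [hev, ← aeval_map_algebraMap k⟮t⟯, hcp, ← algebraMap_smul k⟮t⟯ c p, map_smul,
        algebraMap_smul, Algebra.smul_def]
    have hz : z ∈ k⟮t⟯⟮a • y₀⟯ := htop ▸ mem_top
    obtain ⟨r, s, rfl⟩ := (mem_adjoin_simple_iff _ _).1 hz
    obtain ⟨c, hc, P, hP⟩ := hclear r
    obtain ⟨d, hd, Q, hQ⟩ := hclear s
    by_cases hs : aeval (a • y₀) s = 0
    · exact ⟨0, 1, by simp, by simp [hs]⟩
    · have hC : ∀ u : k[X], aevalAeval t (a • y₀) (C u : k[X][Y]) = algebraMap k[X] K u :=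
        fun u => by simp [hmapK]
      refine ⟨C d * P, C c * Q, ?_, ?_⟩
      · rw [map_mul, hC, hQ]
        exact mul_ne_zero hc (mul_ne_zero hd hs)
      · rw [map_mul, map_mul, hC, hC, hP, hQ]
        field_simp

theorem exists_wtBound {k : Type*} [Field k] {F : k[X][Y]} (hF : F.Monic) :
    ∃ e, 1 ≤ e ∧ WtBound F e F.natDegree := by
  let s := (Finset.range F.natDegree).sup fun j => (F.coeff j).natDegree
  refine ⟨s + 1, by omega, fun j hj => ?_⟩
  rcases hj.eq_or_lt with rfl | hj
  · simp [hF.coeff_natDegree]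
  · have h1 : (F.coeff j).natDegree ≤ s :=
      Finset.le_sup (f := fun j => (F.coeff j).natDegree) (Finset.mem_range.2 hj)
    have h2 := Nat.mul_le_mul_left (s + 1) (Nat.succ_le_of_lt hj)
    rw [Nat.mul_succ] at h2
    omega

theorem exists_bound_forall_exists_place [Finite k] (hK : IsFunctionField k K) :
    ∃ B : ℕ, ∀ n, B ≤ n → ∃ O : ValuationSubring K, IsPlace (algebraMap k K) O ∧
      Nat.card (ResF O) = Nat.card k ^ n := by
  obtain ⟨x, y, F, hx, hF, hirr, hsep, h0, hfrac⟩ := exists_plane_model hK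
  obtain ⟨e, he, hw⟩ := exists_wtBound hF
  set a := 2 * F.natDegree * (2 + e * (F.natDegree - 1))
  set b := 2 * F.natDegree ^ 2 * (e * (F.natDegree - 1))
  refine ⟨2 * (a + b) + 6, fun n hn => exists_place_card_eq hK.constants_closed he hF hirr hw h0
    hsep hx hfrac (by omega) ?_⟩
  have hpow : ∀ j, j ≤ Nat.card k ^ j := fun j => (Nat.lt_pow_self Finite.one_lt_card).le
  have h1 := hpow (n / 2)
  have h2 := hpow (n - n / 2)
  have h3 := natDegree_pos_of_monic_irreducible hF hirr
  rcases Nat.eq_or_lt_of_le h3 with h3 | h3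
  · exact Or.inl ⟨h3.symm, by omega⟩
  · exact Or.inr ⟨h3, by omega, by omega⟩

end Cofinite

section Explicit

theorem sq_le_two_pow {u : ℕ} (hu : 4 ≤ u) : u ^ 2 ≤ 2 ^ u := by
  induction u, hu using Nat.le_induction with
  | base => norm_num
  | succ u hu ih => rw [pow_succ 2]; nlinarith

theorem numerics_of_two_mul_sq_lt {q D m n : ℕ} (hq : 2 ≤ q) (hm : 1 ≤ m) (hmD : m ≤ D)
    (hn : 2 * D ^ 2 < n) :
    (m = 1 ∧ 3 ≤ q ^ (n - n / 2)) ∨ (2 ≤ m ∧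
      2 * m * (2 + (D - m + 1) * (m - 1)) ≤ q ^ (n / 2) ∧
      2 * m ^ 2 * ((D - m + 1) * (m - 1)) ≤ q ^ (n - n / 2)) := by
  have hpow : ∀ {i j : ℕ}, i ≤ j → 2 ^ i ≤ q ^ j := fun {i j} h =>
    (Nat.pow_le_pow_right (by norm_num) h).trans (Nat.pow_le_pow_left hq j)
  have hD : 1 ≤ D ^ 2 := Nat.one_le_pow _ _ (by omega)
  rcases Nat.eq_or_lt_of_le hm with rfl | hm
  · exact Or.inl ⟨rfl, le_trans (by norm_num) (hpow (i := 2) (by omega))⟩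
  · have h1 := hpow (i := D ^ 2) (j := n / 2) (by omega)
    have h2 := hpow (i := D ^ 2 + 1) (j := n - n / 2) (by omega)
    obtain ⟨m, rfl⟩ : ∃ s, m = s + 1 := ⟨m - 1, by omega⟩
    obtain ⟨e, rfl⟩ : ∃ e, D = e + m + 1 := ⟨D - m - 1, by omega⟩
    have h3 : e + m + 1 - (m + 1) + 1 = e + 1 := by omega
    rw [h3, Nat.add_sub_cancel]
    set D := e + m + 1 with hD'
    have h4 : 4 * ((e + 1) * m) ≤ D ^ 2 := by
      rw [hD']; zify; nlinarith [sq_nonneg ((e : ℤ) + 1 - m)]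
    have h5 : 2 ≤ D := by omega
    have h6 : 4 ≤ D ^ 2 := by nlinarith
    have h7 := sq_le_two_pow h6
    have h8 : (m + 1) ^ 2 ≤ D ^ 2 := Nat.pow_le_pow_left hmD 2
    refine Or.inr ⟨hm, le_trans ?_ h1, le_trans ?_ h2⟩
    · refine le_trans ?_ h7
      have : 2 * D ≤ D ^ 2 := by nlinarith
      nlinarith [Nat.mul_le_mul hmD h4]
    · rw [pow_succ 2]
      nlinarith [Nat.mul_le_mul h8 h4]

theorem wtBound_integralNormalization {k : Type*} [Field k] {f : k[X][Y]} {D : ℕ}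
    (hm : 1 ≤ f.natDegree)
    (hD : ∀ j, f.coeff j ≠ 0 → (f.coeff j).natDegree + j ≤ D) :
    WtBound f.integralNormalization (D - f.natDegree + 1) f.natDegree := by
  have hf : f ≠ 0 := by rintro rfl; simp at hm
  have hlc := hD f.natDegree (by simpa using hf)
  rw [coeff_natDegree] at hlc
  intro j hj
  rcases hj.eq_or_lt with rfl | hj
  · simp [integralNormalization_coeff_natDegree hf]
  · rw [integralNormalization_coeff_ne_natDegree hj.ne]
    obtain ⟨i, hi⟩ : ∃ i, f.natDegree = j + i + 1 := ⟨f.natDegree - j - 1, by omega⟩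
    obtain ⟨s, rfl⟩ : ∃ s, D = s + f.natDegree := ⟨D - f.natDegree, by omega⟩
    have h1 : (f.coeff j * f.leadingCoeff ^ (f.natDegree - 1 - j)).natDegree ≤ s + i + 1 + i * s := by
      by_cases h : f.coeff j = 0
      · simp [h]
      · have h2 := hD j h
        refine natDegree_mul_le.trans (add_le_add (by omega) ?_)
        rw [natDegree_pow, hi, show j + i + 1 - 1 - j = i by omega]
        exact Nat.mul_le_mul_left _ (by omega)
    refine (add_le_add_left h1 _).trans ?_
    rw [Nat.add_sub_cancel, hi]
    exact (by ring : _ = _).le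

theorem derivative_integralNormalization_ne_zero {k : Type*} [Field k] {f : k[X][Y]}
    (hf : derivative f ≠ 0) : derivative f.integralNormalization ≠ 0 := by
  have hf0 : f ≠ 0 := by rintro rfl; simp at hf
  contrapose! hf
  ext1 j
  have h1 := congrArg (fun P => coeff P j) hf
  simp only [coeff_derivative, coeff_zero] at h1 ⊢
  by_cases hj : j + 1 = f.natDegree
  · rw [hj, integralNormalization_coeff_natDegree hf0, one_mul] at h1
    rw [h1, mul_zero]
  · rw [integralNormalization_coeff_ne_natDegree hj] at h1
    rcases mul_eq_zero.1 h1 with h | h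
    · rw [(mul_eq_zero.1 h).resolve_right (pow_ne_zero _ (leadingCoeff_ne_zero.2 hf0)), zero_mul]
    · rw [h, mul_zero]

theorem irreducible_integralNormalization {k K : Type*} [Field k] [Field K] [Algebra k K]
    {x y : K} {f : k[X][Y]} (hm : 1 ≤ f.natDegree)
    (h0 : aevalAeval x (aeval x f.leadingCoeff * y) f.integralNormalization = 0)
    (hker : ∀ P : k[X][Y], aevalAeval x y P = 0 → f ∣ P) :
    Irreducible f.integralNormalization := by
  have hf0 : f ≠ 0 := by rintro rfl; simp at hm
  have hmonic := monic_integralNormalization hf0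
  have key : ∀ A B : k[X][Y], f.integralNormalization = A * B →
      aevalAeval x (aeval x f.leadingCoeff * y) A = 0 → IsUnit B := by
    intro A B hAB hA
    have hA0 : A ≠ 0 := by rintro rfl; simp [hmonic.ne_zero] at hAB
    have hB0 : B ≠ 0 := by rintro rfl; simp [hmonic.ne_zero] at hAB
    have h1 : f ∣ A.comp (C f.leadingCoeff * X) := by
      refine hker _ ?_
      rw [← hA, aevalAeval_eq_eval_map, aevalAeval_eq_eval_map, Polynomial.map_comp, eval_comp]
      simp
    have h2 : (C f.leadingCoeff * X).natDegree = 1 := by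
      rw [natDegree_C_mul_X _ (leadingCoeff_ne_zero.2 hf0)]
    have h3 := natDegree_le_of_dvd h1 (by
      rw [Ne, comp_eq_zero_iff, not_or]
      refine ⟨hA0, fun h => ?_⟩
      rw [h.2, natDegree_C] at h2
      omega)
    rw [natDegree_comp, h2, mul_one] at h3
    have h4 := congrArg natDegree hAB
    rw [natDegree_integralNormalization, natDegree_mul hA0 hB0] at h4
    have h5 := congrArg leadingCoeff hAB
    rw [hmonic.leadingCoeff, leadingCoeff_mul] at h5
    have h6 := eq_C_of_natDegree_eq_zero (show B.natDegree = 0 by omega)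
    rw [h6]
    have h7 : B.leadingCoeff = B.coeff 0 := by rw [leadingCoeff, show B.natDegree = 0 by omega]
    exact isUnit_C.2 (IsUnit.of_mul_eq_one A.leadingCoeff (by rw [h5, mul_comm, h7]))
  refine ⟨fun h => ?_, fun A B hAB => ?_⟩
  · have := natDegree_eq_zero_of_isUnit h
    rw [natDegree_integralNormalization] at this
    omega
  · rw [hAB, map_mul] at h0
    rcases mul_eq_zero.1 h0 with h | h
    · exact Or.inr (key A B hAB h)
    · exact Or.inl (key B A (by rw [hAB, mul_comm]) h)

theorem exists_place_of_bivariate {k K : Type} [Field k] [Finite k] [Field K] [Algebra k K]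
    (hk : ∀ x : K, IsAlgebraic k x → ∃ c : k, algebraMap k K c = x) {x y : K} {f : k[X][Y]}
    {D : ℕ} (hD : ∀ j, f.coeff j ≠ 0 → (f.coeff j).natDegree + j ≤ D) (hsep : derivative f ≠ 0)
    (h0 : aevalAeval x y f = 0) (hker : ∀ P : k[X][Y], aevalAeval x y P = 0 → f ∣ P)
    (hfrac : ∀ z : K, ∃ P Q : k[X][Y], aevalAeval x y Q ≠ 0 ∧
      z = aevalAeval x y P / aevalAeval x y Q) {n : ℕ} (hn : 2 * D ^ 2 < n) :
    ∃ O : ValuationSubring K, IsPlace (algebraMap k K) O ∧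
      Nat.card (ResF O) = Nat.card k ^ n := by
  have hf0 : f ≠ 0 := by rintro rfl; simp at hsep
  have hm : 1 ≤ f.natDegree := by
    by_contra! h
    rw [eq_C_of_natDegree_eq_zero (Nat.lt_one_iff.1 h), derivative_C] at hsep
    exact hsep rfl
  have hmD : f.natDegree ≤ D := by
    have := hD f.natDegree (by simpa using hf0)
    omega
  have hx : Transcendental k x := by
    rw [transcendental_iff]
    intro a ha
    by_contra ha0
    have h1 := natDegree_le_of_dvd (hker (C a) (by simpa using ha)) (by simpa using ha0)
    rw [natDegree_C] at h1
    omega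
  set c := aeval x f.leadingCoeff with hc
  have hc0 : c ≠ 0 := fun h => leadingCoeff_ne_zero.2 hf0 ((transcendental_iff.1 hx) _ h)
  have hev : ∀ (w : K) (P : k[X][Y]),
      aevalAeval x w P = P.eval₂ (aeval x : k[X] →ₐ[k] K).toRingHom w := fun w P => by
    rw [aevalAeval_eq_eval_map, eval₂_eq_eval_map]
  have hF0 : aevalAeval x (c * y) f.integralNormalization = 0 := by
    rw [hev, hc]
    have := integralNormalization_eval₂_leadingCoeff_mul hm (aeval x : k[X] →ₐ[k] K).toRingHom y
    rw [← hev y, h0, mul_zero] at this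
    exact this
  have hscale : ∀ P : k[X][Y], aevalAeval x (c * y) (P.scaleRoots f.leadingCoeff) =
      c ^ P.natDegree * aevalAeval x y P := fun P => by
    rw [hev, hev]
    exact scaleRoots_eval₂_mul _ _ _
  have hirr := irreducible_integralNormalization hm hF0 hker
  have hw := wtBound_integralNormalization hm hD
  rw [← natDegree_integralNormalization] at hw
  refine exists_place_card_eq hk (Nat.le_add_left 1 _) (monic_integralNormalization hf0) hirr hw
    hF0 (derivative_integralNormalization_ne_zero hsep) hx (fun z => ?_) (by omega) ?_
  · obtain ⟨P, Q, hQ, rfl⟩ := hfrac z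
    have hC : ∀ u : k[X], aevalAeval x (c * y) (C u : k[X][Y]) = aeval x u := fun u => by simp
    refine ⟨C (f.leadingCoeff ^ Q.natDegree) * P.scaleRoots f.leadingCoeff,
      C (f.leadingCoeff ^ P.natDegree) * Q.scaleRoots f.leadingCoeff, ?_, ?_⟩
    · rw [map_mul, hC, map_pow, hscale]
      exact mul_ne_zero (pow_ne_zero _ hc0) (mul_ne_zero (pow_ne_zero _ hc0) hQ)
    · rw [map_mul, map_mul, hC, hC, map_pow, map_pow, hscale, hscale, ← hc]
      field_simp
  · rw [natDegree_integralNormalization]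
    exact numerics_of_two_mul_sq_lt Finite.one_lt_card hm hmD hn

end Explicit

section MvPolynomial

open MvPolynomial (pderiv)

theorem exists_pow_eq_of_pderiv_eq_zero {σ k : Type*} [Field k] [Finite k] {p : ℕ}
    [Fact p.Prime] [CharP k p] {f : MvPolynomial σ k} (hf : ∀ i, pderiv i f = 0) :
    ∃ g, g ^ p = f := by
  have hdvd : ∀ m ∈ f.support, ∀ i, p ∣ m i := by
    intro m hm i
    rcases Nat.eq_zero_or_pos (m i) with h | h
    · simp [h]
    · have h1 := MvPolynomial.coeff_pderiv (i := i) f (m - Finsupp.single i 1)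
      have h2 : m - Finsupp.single i 1 + Finsupp.single i 1 = m :=
        tsub_add_cancel_of_le (by simpa [Nat.one_le_iff_ne_zero] using h.ne')
      rw [hf, h2, MvPolynomial.coeff_zero, eq_comm, mul_eq_zero] at h1
      have h3 := h1.resolve_left (MvPolynomial.mem_support_iff.1 hm)
      rw [← CharP.cast_eq_zero_iff k p, ← h3, ← Nat.cast_add_one]
      congr 1
      simp
      omega
  choose r hr using fun c : k => (surjective_frobenius k p) c
  refine ⟨∑ m ∈ f.support,
    MvPolynomial.monomial (m.mapRange (· / p) (Nat.zero_div p)) (r (f.coeff m)), ?_⟩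
  conv_rhs => rw [f.as_sum]
  rw [sum_pow_char]
  refine Finset.sum_congr rfl fun m hm => ?_
  have h1 : p • m.mapRange (· / p) (Nat.zero_div p) = m := by
    ext i
    simp [Nat.mul_div_cancel' (hdvd m hm i)]
  have h2 : r (f.coeff m) ^ p = f.coeff m := hr _
  rw [MvPolynomial.monomial_pow, h1, h2]

theorem coeff_coeff_eq_coeff_equivMvPolynomial {k : Type*} [Field k] (P : k[X][Y]) (i j : ℕ) :
    (P.coeff j).coeff i = MvPolynomial.coeff (Finsupp.single 0 i + Finsupp.single 1 j)
      (Bivariate.equivMvPolynomial k P) := by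
  induction P using Polynomial.induction_on' with
  | add P Q hP hQ => simp [hP, hQ]
  | monomial b P =>
    induction P using Polynomial.induction_on' with
    | add P Q hP hQ => simp [hP, hQ]
    | monomial a c =>
      have h1 : Bivariate.equivMvPolynomial k (monomial b (monomial a c)) =
          MvPolynomial.monomial (Finsupp.single 0 a + Finsupp.single 1 b) c := by
        rw [← C_mul_X_pow_eq_monomial, ← C_mul_X_pow_eq_monomial]
        rw [MvPolynomial.monomial_add_single, ← zero_add (Finsupp.single 0 a),
          MvPolynomial.monomial_add_single]
        simp
      have h2 : Finsupp.single (0 : Fin 2) a + Finsupp.single 1 b =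
          Finsupp.single 0 i + Finsupp.single 1 j ↔ b = j ∧ a = i := by
        simp [Finsupp.ext_iff, Fin.forall_fin_two, and_comm]
      rw [h1, MvPolynomial.coeff_monomial, coeff_monomial, ite_congr (propext h2) (fun _ => rfl)
        (fun _ => rfl), ite_and]
      split_ifs <;> simp_all [coeff_monomial]

theorem exists_place_of_mvPolynomial {k K : Type} [Field k] [Finite k] [Field K] [Algebra k K]
    (hk : ∀ x : K, IsAlgebraic k x → ∃ c : k, algebraMap k K c = x)
    {f : MvPolynomial (Fin 2) k} (π : MvPolynomial (Fin 2) k →ₐ[k] K) {D : ℕ}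
    (hD : f.totalDegree ≤ D) (hker : RingHom.ker π = Ideal.span {f})
    (hfrac : ∀ z : K, ∃ a b, π b ≠ 0 ∧ z = π a / π b) (hf : pderiv 1 f ≠ 0) {n : ℕ}
    (hn : 2 * D ^ 2 < n) :
    ∃ O : ValuationSubring K, IsPlace (algebraMap k K) O ∧
      Nat.card (ResF O) = Nat.card k ^ n := by
  let ε := Bivariate.equivMvPolynomial k
  have hπ : ∀ P : k[X][Y], aevalAeval (π (.X 0)) (π (.X 1)) P = π (ε P) := fun P =>
    aevalAeval_algHom_apply π _ _ P
  have hmem : ∀ a, π a = 0 ↔ f ∣ a := fun a => by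
    rw [← Ideal.mem_span_singleton, ← hker, RingHom.mem_ker]
  refine exists_place_of_bivariate hk (f := ε.symm f) (x := π (.X 0)) (y := π (.X 1)) (D := D)
    (fun j hj => ?_) (fun h => hf ?_) ?_ (fun P hP => ?_) (fun z => ?_) hn
  · have h1 := leadingCoeff_ne_zero.2 hj
    rw [leadingCoeff, coeff_coeff_eq_coeff_equivMvPolynomial] at h1
    have h2 := MvPolynomial.le_totalDegree (MvPolynomial.mem_support_iff.2 h1)
    rw [AlgEquiv.apply_symm_apply, Finsupp.sum_fintype _ _ (fun _ => rfl)] at h2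
    simpa using h2.trans hD
  · have h1 := Bivariate.pderiv_one_equivMvPolynomial (ε.symm f)
    rwa [h, map_zero, AlgEquiv.apply_symm_apply] at h1
  · rw [hπ, AlgEquiv.apply_symm_apply, hmem]
  · rw [hπ, hmem] at hP
    simpa using map_dvd ε.symm hP
  · obtain ⟨a, b, hb, rfl⟩ := hfrac z
    exact ⟨ε.symm a, ε.symm b, by simpa [hπ] using hb, by simp [hπ]⟩

theorem exists_place_of_irreducible {k K : Type} [Field k] [Finite k] [Field K] [Algebra k K]
    (hk : ∀ x : K, IsAlgebraic k x → ∃ c : k, algebraMap k K c = x)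
    {f : MvPolynomial (Fin 2) k} (hf : Irreducible f) (π : MvPolynomial (Fin 2) k →ₐ[k] K)
    (hker : RingHom.ker π = Ideal.span {f})
    (hfrac : ∀ z : K, ∃ a b, π b ≠ 0 ∧ z = π a / π b) {n : ℕ}
    (hn : 2 * f.totalDegree ^ 2 < n) :
    ∃ O : ValuationSubring K, IsPlace (algebraMap k K) O ∧
      Nat.card (ResF O) = Nat.card k ^ n := by
  by_cases h1 : pderiv 1 f = 0
  · have h0 : pderiv 0 f ≠ 0 := by
      intro h0
      obtain ⟨p, hp⟩ := CharP.exists k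
      have hp' : Fact p.Prime := ⟨CharP.char_is_prime k p⟩
      obtain ⟨g, rfl⟩ := exists_pow_eq_of_pderiv_eq_zero (p := p)
        (Fin.forall_fin_two.2 ⟨h0, h1⟩)
      exact not_irreducible_pow hp'.out.one_lt.ne' hf
    let τ := MvPolynomial.renameEquiv k (Equiv.swap (0 : Fin 2) 1)
    have hττ : ∀ a, τ (τ a) = a := fun a => by
      simp [τ, MvPolynomial.rename_rename, ← Equiv.coe_trans]
    refine exists_place_of_mvPolynomial hk (f := τ f) (π.comp τ.toAlgHom)
      (D := f.totalDegree) (MvPolynomial.totalDegree_renameEquiv _ _).le ?_ (fun z => ?_) ?_ hn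
    · ext a
      have h2 : a ∈ RingHom.ker (π.comp τ.toAlgHom) ↔ τ a ∈ RingHom.ker π := Iff.rfl
      rw [h2, hker, Ideal.mem_span_singleton, Ideal.mem_span_singleton]
      exact ⟨fun h => by simpa [hττ] using map_dvd τ h, fun h => by simpa [hττ] using map_dvd τ h⟩
    · obtain ⟨a, b, hb, rfl⟩ := hfrac z
      exact ⟨τ a, τ b, by simpa [hττ] using hb, by simp [hττ]⟩
    · have h2 := MvPolynomial.pderiv_rename (Equiv.swap (0 : Fin 2) 1).injective 0 f
      rw [Equiv.swap_apply_left] at h2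
      rw [MvPolynomial.renameEquiv_apply, h2]
      exact fun h => h0 (MvPolynomial.rename_injective _ (Equiv.injective _) (by rw [h, map_zero]))
  · exact exists_place_of_mvPolynomial hk π le_rfl hker hfrac h1 hn

end MvPolynomial

end CurvePoints

/-- Lemma 3.3: residue cardinalities of places of a global function field. -/
theorem residue_card_places (k K : Type) [Field k] [Finite k] [Field K] [Algebra k K]
    (hK : IsFunctionField k K) :
    -- the map `v ↦ |Kv|` has finite fibres
    (∀ n : ℕ, {v : Places k K | Nat.card (ResF v.1) = n}.Finite)
    -- `R(K)` is a cofinite subset of `{qⁿ : n ∈ ℕ}`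
    ∧ {n : ℕ | ∃ v : Places k K, Nat.card (ResF v.1) = n} ⊆
        {n : ℕ | ∃ m : ℕ, 1 ≤ m ∧ n = Nat.card k ^ m}
    ∧ ({n : ℕ | ∃ m : ℕ, 1 ≤ m ∧ n = Nat.card k ^ m} \
        {n : ℕ | ∃ v : Places k K, Nat.card (ResF v.1) = n}).Finite
    -- if `K = K_f` with `f` absolutely irreducible, then every power of `q` missing from
    -- `R(K)` is at most `q ^ (2 deg(f)²)`
    ∧ ∀ (f : MvPolynomial (Fin 2) k) (π : MvPolynomial (Fin 2) k →+* K),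
        Irreducible (MvPolynomial.map (algebraMap k (AlgebraicClosure k)) f) →
        (∀ a : k, π (MvPolynomial.C a) = algebraMap k K a) →
        RingHom.ker π = Ideal.span {f} →
        (∀ z : K, ∃ a b : MvPolynomial (Fin 2) k, π b ≠ 0 ∧ z = π a / π b) →
        ∀ m : ℕ, 1 ≤ m →
          Nat.card k ^ m ∉ {n : ℕ | ∃ v : Places k K, Nat.card (ResF v.1) = n} →
          Nat.card k ^ m ≤ Nat.card k ^ (2 * f.totalDegree ^ 2) := by
  refine ⟨fun n => ?_, ?_, ?_, fun f π hf hC hker hfrac m hm hmem => ?_⟩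
  · rcases Nat.lt_or_ge 1 n with hn | hn
    · exact (CurvePoints.finite_places hK hn).preimage
        (f := fun v : Places k K => v.1) Subtype.val_injective.injOn |>.subset
          fun v hv => ⟨v.2, hv⟩
    · convert Set.finite_empty
      refine Set.eq_empty_of_forall_notMem fun v hv => ?_
      obtain ⟨m, hm, h⟩ := CurvePoints.card_resF_of_isPlace hK v.2
      have := Nat.one_lt_pow (Nat.one_le_iff_ne_zero.1 hm) (Finite.one_lt_card (α := k))
      have hv : Nat.card (ResF v.1) = n := hv
      omega
  · rintro n ⟨v, rfl⟩
    exact CurvePoints.card_resF_of_isPlace hK v.2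
  · obtain ⟨B, hB⟩ := CurvePoints.exists_bound_forall_exists_place hK
    refine ((Set.finite_lt_nat B).image (Nat.card k ^ ·)).subset ?_
    rintro _ ⟨⟨m, -, rfl⟩, hm⟩
    refine ⟨m, ?_, rfl⟩
    by_contra h
    obtain ⟨O, hO, hcard⟩ := hB m (not_lt.1 h)
    exact hm ⟨⟨O, hO⟩, hcard⟩
  · refine Nat.pow_le_pow_right Nat.card_pos ?_
    by_contra! hlt
    have hf0 : f ≠ 0 := by
      rintro rfl
      exact hf.ne_zero (map_zero _)
    have hprime : Prime f := by
      rw [← Ideal.span_singleton_prime hf0, ← hker]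
      exact RingHom.ker_isPrime π
    obtain ⟨O, hO, hcard⟩ := CurvePoints.exists_place_of_irreducible hK.constants_closed
      hprime.irreducible { π with commutes' := hC } hker hfrac hlt
    exact hmem ⟨⟨O, hO⟩, hcard⟩
end
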